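/- arXiv:1908.04191 — 3 statements merged into one kernel-verified Lean document; each statement's English description precedes it below -/
import Mathlib

section
/- Let α > 1/2 and let D = {y ∈ ℝ³_{≥0} : y₁y₂ + y₁y₃ + y₂y₃ ≥ (y₁² + y₂² + y₃²)/2}. Then for every x ∈ ℝ³_{>0}, (x₁x₂ + x₁x₃ + x₂x₃)^{−α} = ∫_D e^{−⟨y,x⟩} q(y) dy, where q(y) = 2^{1−α} / ((2π)^{1/2} Γ(α) Γ(α − 1/2)) · (y₁y₂ + y₁y₃ + y₂y₃ − (y₁² + y₂² + y₃²)/2)^{α − 3/2}. In particular, since q ≥ 0 on D, the function x ↦ (x₁x₂ + x₁x₃ + x₂x₃)^{−α} is completely monotone on ℝ³_{>0}. -/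
open MeasureTheory Real Set

noncomputable def iterDirDeriv {E : Type*} [NormedAddCommGroup E] [NormedSpace ℝ E] :
    ℕ → (ℕ → E) → (E → ℝ) → E → ℝ
  | 0, _, f => f
  | (k+1), v, f => fun x => fderiv ℝ (iterDirDeriv k (fun i => v (i+1)) f) x (v 0)

/-- A function is completely monotone on `C` if it is smooth on `C` and its iterated
directional derivatives along vectors of `C` satisfy the alternating sign condition. -/
def CompletelyMonotoneOn {E : Type*} [NormedAddCommGroup E] [NormedSpace ℝ E]
    (f : E → ℝ) (C : Set E) : Prop :=
  ContDiffOn ℝ (⊤ : ℕ∞) f C ∧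
  ∀ (k : ℕ) (v : ℕ → E), (∀ i, v i ∈ C) → ∀ x ∈ C, 0 ≤ (-1 : ℝ) ^ k * iterDirDeriv k v f x

/-- All iterated backward differences of `g` of order `n` along vectors of `C` are nonnegative
on `C`. -/
def AlternatingDifferences {E : Type*} [AddCommGroup E] (C : Set E) : ℕ → (E → ℝ) → Prop
  | 0, g => ∀ x ∈ C, 0 ≤ g x
  | (n + 1), g => ∀ v ∈ C, AlternatingDifferences C n (fun x => g x - g (x + v))

lemma AlternatingDifferences.congr {E : Type*} [AddCommGroup E] {C : Set E}
    (hadd : ∀ x ∈ C, ∀ y ∈ C, x + y ∈ C) {n : ℕ} {f g : E → ℝ} (hfg : EqOn f g C)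
    (hf : AlternatingDifferences C n f) : AlternatingDifferences C n g := by
  induction n generalizing f g with
  | zero => exact fun x hx => hfg hx ▸ hf x hx
  | succ n ih =>
    intro v hv
    refine ih (fun x hx => ?_) (hf v hv)
    simp only [hfg hx, hfg (hadd x hx v hv)]

lemma AlternatingDifferences.neg_fderiv {E : Type*} [NormedAddCommGroup E] [NormedSpace ℝ E]
    {C : Set E} (hC : IsOpen C) (hadd : ∀ x ∈ C, ∀ y ∈ C, x + y ∈ C)
    (hsmul : ∀ x ∈ C, ∀ t : ℝ, 0 < t → t • x ∈ C) {g : E → ℝ} (hg : DifferentiableOn ℝ g C)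
    (h : ∀ n, AlternatingDifferences C n g) {v : E} (hv : v ∈ C) (n : ℕ) :
    AlternatingDifferences C n (fun x => -fderiv ℝ g x v) := by
  induction n generalizing g with
  | zero =>
    intro x hx
    have hd : HasFDerivAt g (fderiv ℝ g x) x :=
      (hg.differentiableAt (hC.mem_nhds hx)).hasFDerivAt
    have hline : HasDerivAt (fun t : ℝ => g (x + t • v)) (fderiv ℝ g x v) 0 := by
      have h1 : HasDerivAt (fun t : ℝ => x + t • v) v 0 := by
        simpa using ((hasDerivAt_id (0 : ℝ)).smul_const v).const_add x
      have h2 : HasFDerivAt g (fderiv ℝ g x) (x + (0 : ℝ) • v) := by simpa using hd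
      exact h2.comp_hasDerivAt (0 : ℝ) h1
    have ht := hline.hasDerivWithinAt (s := Ioi 0)
    rw [hasDerivWithinAt_iff_tendsto_slope' (by simp)] at ht
    have hle : fderiv ℝ g x v ≤ 0 := by
      refine le_of_tendsto ht ?_
      filter_upwards [self_mem_nhdsWithin] with t ht
      have ht : 0 < t := ht
      have h1 : 0 ≤ g x - g (x + t • v) := h 1 (t • v) (hsmul v hv t ht) x hx
      simp only [slope, sub_zero, zero_smul, add_zero, vsub_eq_sub, smul_eq_mul]
      exact mul_nonpos_of_nonneg_of_nonpos (by positivity) (by linarith)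
    show 0 ≤ -fderiv ℝ g x v
    linarith
  | succ n ih =>
    intro u hu
    have hshift : ∀ x ∈ C, HasFDerivAt (fun x => g x - g (x + u))
        (fderiv ℝ g x - fderiv ℝ g (x + u)) x := by
      intro x hx
      have h1 := (hg.differentiableAt (hC.mem_nhds hx)).hasFDerivAt
      have h2 := (hg.differentiableAt (hC.mem_nhds (hadd x hx u hu))).hasFDerivAt
      exact h1.sub ((hasFDerivAt_comp_add_right u).2 h2)
    refine (ih (g := fun x => g x - g (x + u))
      (fun x hx => (hshift x hx).differentiableAt.differentiableWithinAt)
      (fun m => h (m + 1) u hu)).congr hadd (fun x hx => ?_)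
    simp only [(hshift x hx).fderiv, sub_apply]
    ring

lemma completelyMonotoneOn_of_alternatingDifferences {E : Type*} [NormedAddCommGroup E]
    [NormedSpace ℝ E] {C : Set E} (hC : IsOpen C) (hadd : ∀ x ∈ C, ∀ y ∈ C, x + y ∈ C)
    (hsmul : ∀ x ∈ C, ∀ t : ℝ, 0 < t → t • x ∈ C) {f : E → ℝ}
    (hf : ContDiffOn ℝ (⊤ : ℕ∞) f C) (h : ∀ n, AlternatingDifferences C n f) :
    CompletelyMonotoneOn f C := by
  refine ⟨hf, fun k v hv => ?_⟩
  suffices H : ContDiffOn ℝ (⊤ : ℕ∞) (iterDirDeriv k v f) C ∧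
      ∀ n, AlternatingDifferences C n (fun x => (-1 : ℝ) ^ k * iterDirDeriv k v f x) from
    H.2 0
  induction k generalizing v with
  | zero => exact ⟨hf, fun n => by simpa [iterDirDeriv] using h n⟩
  | succ k ih =>
    obtain ⟨hs, hd⟩ := ih (fun i => v (i + 1)) (fun i => hv _)
    refine ⟨?_, fun n => ?_⟩
    · exact (hs.fderiv_of_isOpen (m := (⊤ : ℕ∞)) hC (by simp)).clm_apply contDiffOn_const
    · have hdiff : DifferentiableOn ℝ (iterDirDeriv k (fun i => v (i + 1)) f) C :=
        hs.differentiableOn (by simp)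
      refine (AlternatingDifferences.neg_fderiv hC hadd hsmul (hdiff.const_mul ((-1 : ℝ) ^ k)) hd
        (hv 0) n).congr hadd (fun x hx => ?_)
      have := (hdiff.differentiableAt (hC.mem_nhds hx)).hasFDerivAt.const_mul ((-1 : ℝ) ^ k)
      simp only [iterDirDeriv, this.fderiv, smul_apply, smul_eq_mul]
      ring

lemma alternatingDifferences_integral_exp {E Y : Type*} [AddCommGroup E] [MeasurableSpace Y]
    {C : Set E} (hadd : ∀ x ∈ C, ∀ y ∈ C, x + y ∈ C) {μ : Measure Y} {p : Y → E → ℝ}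
    (hpadd : ∀ y, ∀ x x', p y (x + x') = p y x + p y x')
    {w : Y → ℝ} (hw : ∀ᵐ y ∂μ, 0 ≤ w y) (hp : ∀ x ∈ C, ∀ᵐ y ∂μ, 0 ≤ p y x)
    (hint : ∀ x ∈ C, Integrable (fun y => exp (-p y x) * w y) μ) (n : ℕ) :
    AlternatingDifferences C n (fun x => ∫ y, exp (-p y x) * w y ∂μ) := by
  induction n generalizing w with
  | zero =>
    intro x _
    exact integral_nonneg_of_ae (hw.mono fun y hy => mul_nonneg (exp_pos _).le hy)
  | succ n ih =>
    intro v hv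
    have key : ∀ x y, exp (-p y x) * w y - exp (-p y (x + v)) * w y =
        exp (-p y x) * ((1 - exp (-p y v)) * w y) := by
      intro x y
      rw [hpadd, neg_add, exp_add]
      ring
    refine (ih (w := fun y => (1 - exp (-p y v)) * w y) ?_ fun x hx => ?_).congr hadd
      fun x hx => ?_
    · filter_upwards [hw, hp v hv] with y h1 h2
      exact mul_nonneg (by simpa using h2) h1
    · simpa only [Pi.sub_def, key] using (hint x hx).sub (hint _ (hadd x hx v hv))
    · simp only [← key]
      exact integral_sub (hint x hx) (hint _ (hadd x hx v hv))

lemma lintegral_rpow_mul_exp_neg_mul_Ioi {s r : ℝ} (hs : 0 < s) (hr : 0 < r) :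
    ∫⁻ t in Ioi 0, ENNReal.ofReal (t ^ (s - 1) * exp (-(r * t))) =
      ENNReal.ofReal ((1 / r) ^ s * Gamma s) := by
  rw [← integral_rpow_mul_exp_neg_mul_Ioi hs hr, ofReal_integral_eq_lintegral_ofReal]
  · have := integrableOn_rpow_mul_exp_neg_mul_rpow (p := 1) (s := s - 1) (b := r) (by linarith)
      one_pos hr
    simpa [IntegrableOn] using this
  · refine (ae_restrict_iff' measurableSet_Ioi).2 (ae_of_all _ fun t ht => ?_)
    have ht : 0 < t := ht
    show 0 ≤ t ^ (s - 1) * exp (-(r * t))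
    positivity

lemma lintegral_exp_neg_quadratic {p : ℝ} (hp : 0 < p) (c : ℝ) :
    ∫⁻ w : ℝ, ENNReal.ofReal (exp (-(p * w ^ 2 + c * w))) =
      ENNReal.ofReal (√(π / p) * exp (c ^ 2 / (4 * p))) := by
  have h : ∀ w : ℝ, ENNReal.ofReal (exp (-(p * (w - c / (2 * p)) ^ 2 + c * (w - c / (2 * p))))) =
      ENNReal.ofReal (exp (-p * w ^ 2)) * ENNReal.ofReal (exp (c ^ 2 / (4 * p))) := by
    intro w
    rw [← ENNReal.ofReal_mul (exp_pos _).le, ← exp_add]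
    congr 2
    field_simp
    ring
  rw [← lintegral_sub_right_eq_self _ (c / (2 * p))]
  simp_rw [h]
  rw [lintegral_mul_const _ (by fun_prop), ← ofReal_integral_eq_lintegral_ofReal
    (integrable_exp_neg_mul_sq hp) (ae_of_all _ fun _ => (exp_pos _).le), integral_gaussian,
    ENNReal.ofReal_mul (sqrt_nonneg _)]

lemma lintegral_fin_three {F : (Fin 3 → ℝ) → ENNReal} (hF : Measurable F) :
    ∫⁻ y, F y = ∫⁻ a : ℝ, ∫⁻ b : ℝ, ∫⁻ c : ℝ, F ![a, b, c] := by
  have h1 := (volume_preserving_piFinSuccAbove (fun _ : Fin 3 => ℝ) 0).symm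
  rw [← h1.lintegral_comp hF, Measure.volume_eq_prod, lintegral_prod _ (by fun_prop)]
  refine lintegral_congr fun a => ?_
  have h2 := (volume_preserving_finTwoArrow ℝ).symm
  rw [← h2.lintegral_comp (by fun_prop), Measure.volume_eq_prod, lintegral_prod _ (by fun_prop)]
  refine lintegral_congr fun b => lintegral_congr fun c => congrArg F ?_
  ext i
  fin_cases i <;> rfl

/-- The dual Lorentz cone of the quadratic form `x₁x₂ + x₁x₃ + x₂x₃`. -/
def dualCone : Set (Fin 3 → ℝ) :=
  {y : Fin 3 → ℝ | (∀ i, 0 ≤ y i) ∧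
    (y 0 ^ 2 + y 1 ^ 2 + y 2 ^ 2) / 2 ≤ y 0 * y 1 + y 0 * y 2 + y 1 * y 2}

/-- The Riesz kernel of the quadratic form `x₁x₂ + x₁x₃ + x₂x₃`. -/
noncomputable def rieszKernel (α : ℝ) (y : Fin 3 → ℝ) : ℝ :=
  2 ^ (1 - α) / (√(2 * π) * Gamma α * Gamma (α - 1 / 2)) *
    (y 0 * y 1 + y 0 * y 2 + y 1 * y 2 - (y 0 ^ 2 + y 1 ^ 2 + y 2 ^ 2) / 2) ^ (α - 3 / 2)

lemma measurableSet_dualCone : MeasurableSet dualCone := by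
  have h1 : Measurable fun y : Fin 3 → ℝ => (y 0 ^ 2 + y 1 ^ 2 + y 2 ^ 2) / 2 := by fun_prop
  have h2 : Measurable fun y : Fin 3 → ℝ => y 0 * y 1 + y 0 * y 2 + y 1 * y 2 := by fun_prop
  exact (measurableSet_Ici (a := (0 : Fin 3 → ℝ))).inter (measurableSet_le h1 h2)

lemma measurable_rieszKernel (α : ℝ) : Measurable (rieszKernel α) := by
  unfold rieszKernel
  fun_prop

lemma rieszKernel_nonneg {α : ℝ} (hα : 1 / 2 < α) {y : Fin 3 → ℝ} (hy : y ∈ dualCone) :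
    0 ≤ rieszKernel α y := by
  have h1 := Gamma_pos_of_pos (show 0 < α by linarith)
  have h2 := Gamma_pos_of_pos (show 0 < α - 1 / 2 by linarith)
  have h3 := rpow_nonneg (sub_nonneg.2 hy.2) (α - 3 / 2)
  unfold rieszKernel
  positivity

lemma not_mem_dualCone_of_neg {a b c : ℝ} (ha : a < 0) : ![a, b, c] ∉ dualCone :=
  fun h => absurd (h.1 0) (by simpa using ha)

lemma mem_dualCone_iff {a u w : ℝ} (ha : 0 < a) :
    ![a, u + w ^ 2 / (4 * a), w + (a + (u + w ^ 2 / (4 * a)))] ∈ dualCone ↔ 0 ≤ u := by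
  have key : ∀ b : ℝ, a * b + a * (w + (a + b)) + b * (w + (a + b)) -
      (a ^ 2 + b ^ 2 + (w + (a + b)) ^ 2) / 2 = 2 * a * b - w ^ 2 / 2 := fun b => by ring
  have hq : 2 * a * (u + w ^ 2 / (4 * a)) - w ^ 2 / 2 = 2 * a * u := by field_simp; ring
  simp only [dualCone, mem_ofPred_eq, Fin.forall_fin_succ]
  simp only [Matrix.cons_val, Fin.succ_zero_eq_one, Fin.succ_one_eq_two, IsEmpty.forall_iff,
    and_true]
  rw [← sub_nonneg (b := (_ : ℝ) / 2), key, hq]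
  constructor
  · rintro ⟨-, h⟩
    exact nonneg_of_mul_nonneg_right h (by positivity)
  · intro hu
    have hs : w + (a + (u + w ^ 2 / (4 * a))) = u + (w + 2 * a) ^ 2 / (4 * a) := by
      field_simp
      ring
    refine ⟨⟨ha.le, by positivity, ?_⟩, by positivity⟩
    rw [hs]
    positivity

lemma lintegral_rieszKernel {α : ℝ} (hα : 1 / 2 < α) {x : Fin 3 → ℝ} (hx : ∀ i, 0 < x i) :
    ∫⁻ y in dualCone, ENNReal.ofReal (exp (-(∑ i, y i * x i)) * rieszKernel α y) =
      ENNReal.ofReal ((x 0 * x 1 + x 0 * x 2 + x 1 * x 2) ^ (-α)) := by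
  have hx0 := hx 0
  have hx1 := hx 1
  have hx2 := hx 2
  have hΓ := Gamma_pos_of_pos (show 0 < α by linarith)
  have hΓ' := Gamma_pos_of_pos (show 0 < α - 1 / 2 by linarith)
  have hmK := measurable_rieszKernel α
  set A := x 0 + x 2 with hA
  set B := x 1 + x 2 with hB
  set c := x 2 with hc
  have hBpos : 0 < B := by positivity
  set K : ℝ := 2 ^ (1 - α) / (√(2 * π) * Gamma α * Gamma (α - 1 / 2)) with hK
  have hKpos : 0 < K := by positivity
  set F : (Fin 3 → ℝ) → ENNReal := dualCone.indicator
    fun y => ENNReal.ofReal (exp (-(∑ i, y i * x i)) * rieszKernel α y) with hFdef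
  have hF : Measurable F := Measurable.indicator (by fun_prop) measurableSet_dualCone
  set M : ℝ := K * 2 ^ (α - 3 / 2) * ((1 / B) ^ (α - 1 / 2) * Gamma (α - 1 / 2)) *
    √(4 * π / B) with hM
  have hMpos : 0 < M := by positivity
  set R : ℝ := A - c ^ 2 / B with hR
  have hRB : R * B = x 0 * x 1 + x 0 * x 2 + x 1 * x 2 := by
    rw [hR, sub_mul, div_mul_cancel₀ _ hBpos.ne', hA, hB, hc]
    ring
  have hRpos : 0 < R := by
    refine pos_of_mul_pos_left (b := B) ?_ hBpos.le
    rw [hRB]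
    positivity
  have hinner : ∀ a : ℝ, 0 < a → ∫⁻ b : ℝ, ∫⁻ z : ℝ, F ![a, b, z] =
      ENNReal.ofReal M * ENNReal.ofReal (a ^ (α - 1) * exp (-(R * a))) := by
    intro a ha
    have hval : ∀ w u : ℝ, F ![a, u + w ^ 2 / (4 * a), w + (a + (u + w ^ 2 / (4 * a)))] =
        ENNReal.ofReal (K * (2 * a) ^ (α - 3 / 2) * exp (-(a * A))) *
          ENNReal.ofReal (exp (-(B / (4 * a) * w ^ 2 + c * w))) *
          (Ici 0).indicator
            (fun u => ENNReal.ofReal (u ^ (α - 1 / 2 - 1) * exp (-(B * u)))) u := by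
      intro w u
      by_cases hu : 0 ≤ u
      · have hq : (a * (u + w ^ 2 / (4 * a)) + a * (w + (a + (u + w ^ 2 / (4 * a)))) +
            (u + w ^ 2 / (4 * a)) * (w + (a + (u + w ^ 2 / (4 * a)))) -
            (a ^ 2 + (u + w ^ 2 / (4 * a)) ^ 2 + (w + (a + (u + w ^ 2 / (4 * a)))) ^ 2) / 2) =
            2 * a * u := by
          field_simp
          ring
        have he : exp (-(a * x 0 + (u + w ^ 2 / (4 * a)) * x 1 +
            (w + (a + (u + w ^ 2 / (4 * a)))) * x 2)) =
            exp (-(a * A)) * exp (-(B / (4 * a) * w ^ 2 + c * w)) * exp (-(B * u)) := by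
          rw [← exp_add, ← exp_add]
          congr 1
          rw [hA, hB, hc]
          field_simp
          ring
        rw [hFdef, indicator_of_mem ((mem_dualCone_iff ha).2 hu), indicator_of_mem (mem_Ici.2 hu),
          ← ENNReal.ofReal_mul (by positivity), ← ENNReal.ofReal_mul (by positivity)]
        congr 1
        simp only [rieszKernel, Fin.sum_univ_three, Matrix.cons_val]
        rw [hq, he, mul_rpow (by positivity) hu, show α - 1 / 2 - 1 = α - 3 / 2 by ring, ← hK]
        ring
      · rw [hFdef, indicator_of_notMem (mt (mem_dualCone_iff ha).1 hu),
          indicator_of_notMem (by simpa using hu), mul_zero]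
    calc ∫⁻ b : ℝ, ∫⁻ z : ℝ, F ![a, b, z]
        = ∫⁻ b : ℝ, ∫⁻ w : ℝ, F ![a, b, w + (a + b)] :=
          lintegral_congr fun b => (lintegral_add_right_eq_self (fun z => F ![a, b, z]) _).symm
      _ = ∫⁻ w : ℝ, ∫⁻ b : ℝ, F ![a, b, w + (a + b)] := by
          refine lintegral_lintegral_swap (Measurable.aemeasurable ?_)
          refine hF.comp (measurable_pi_iff.2 fun i => ?_)
          fin_cases i <;> simp <;> fun_prop
      _ = ∫⁻ w : ℝ, ∫⁻ u : ℝ,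
            F ![a, u + w ^ 2 / (4 * a), w + (a + (u + w ^ 2 / (4 * a)))] :=
          lintegral_congr fun w =>
            (lintegral_add_right_eq_self (fun b => F ![a, b, w + (a + b)]) _).symm
      _ = ENNReal.ofReal (K * (2 * a) ^ (α - 3 / 2) * exp (-(a * A))) *
          ENNReal.ofReal (√(π / (B / (4 * a))) * exp (c ^ 2 / (4 * (B / (4 * a))))) *
          ENNReal.ofReal ((1 / B) ^ (α - 1 / 2) * Gamma (α - 1 / 2)) := by
          simp_rw [hval]
          have hmeas : Measurable ((Ici 0).indicator
              (fun u : ℝ => ENNReal.ofReal (u ^ (α - 1 / 2 - 1) * exp (-(B * u))))) :=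
            Measurable.indicator (by fun_prop) measurableSet_Ici
          simp_rw [lintegral_const_mul _ hmeas]
          rw [lintegral_mul_const _ (by fun_prop), lintegral_const_mul _ (by fun_prop),
            lintegral_exp_neg_quadratic (by positivity), lintegral_indicator measurableSet_Ici,
            setLIntegral_congr Ioi_ae_eq_Ici.symm,
            lintegral_rpow_mul_exp_neg_mul_Ioi (by linarith) hBpos]
      _ = _ := by
          rw [← ENNReal.ofReal_mul (by positivity), ← ENNReal.ofReal_mul (by positivity),
            ← ENNReal.ofReal_mul (by positivity)]
          congr 1
          have h1 : √(π / (B / (4 * a))) = √(4 * π / B) * a ^ (1 / 2 : ℝ) := by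
            rw [← sqrt_eq_rpow, ← sqrt_mul (by positivity)]
            congr 1
            field_simp
          have h2 : exp (-(R * a)) = exp (-(a * A)) * exp (c ^ 2 / (4 * (B / (4 * a)))) := by
            rw [← exp_add, hR]
            congr 1
            field_simp
            ring
          have h3 : a ^ (α - 1) = a ^ (α - 3 / 2) * a ^ (1 / 2 : ℝ) := by
            rw [← rpow_add ha]
            congr 1
            ring
          rw [h1, h2, h3, mul_rpow (by positivity) ha.le, hM]
          ring
  have hconst : M * ((1 / R) ^ α * Gamma α) =
      (x 0 * x 1 + x 0 * x 2 + x 1 * x 2) ^ (-α) := by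
    have h1 : √(4 * π / B) = 2 * √π * (1 / B) ^ (1 / 2 : ℝ) := by
      rw [← sqrt_eq_rpow, show 4 * π / B = 2 ^ 2 * π * (1 / B) by ring,
        sqrt_mul (by positivity), sqrt_mul (by positivity), sqrt_sq (by norm_num)]
    have h2 : (1 / B) ^ (α - 1 / 2) * (1 / B) ^ (1 / 2 : ℝ) = (1 / B) ^ α := by
      rw [← rpow_add (by positivity)]
      congr 1
      ring
    have h3 : (2 : ℝ) ^ (1 - α) * 2 ^ (α - 3 / 2) * 2 = √2 := by
      rw [← rpow_add two_pos, ← rpow_add_one two_ne_zero, sqrt_eq_rpow]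
      congr 1
      ring
    rw [← hRB, rpow_neg (by positivity), ← inv_rpow (by positivity),
      show (R * B)⁻¹ = 1 / B * (1 / R) by field_simp, mul_rpow (by positivity) (by positivity),
      ← h2, hM, h1, hK, sqrt_mul (by norm_num), ← h3]
    generalize Gamma (α - 1 / 2) = G at hΓ' ⊢
    field_simp
  rw [← lintegral_indicator measurableSet_dualCone, lintegral_fin_three hF, ← hconst,
    ENNReal.ofReal_mul hMpos.le, ← lintegral_rpow_mul_exp_neg_mul_Ioi (by linarith) hRpos,
    ← lintegral_const_mul _ (by fun_prop), ← lintegral_indicator measurableSet_Ioi]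
  refine lintegral_congr_ae ?_
  filter_upwards [compl_mem_ae_iff.2 (measure_singleton (0 : ℝ))] with a ha
  rcases lt_or_gt_of_ne (show a ≠ 0 from ha) with h | h
  · rw [indicator_of_notMem (by simpa using h.le)]
    simp [hFdef, indicator_of_notMem (not_mem_dualCone_of_neg h)]
  · rw [indicator_of_mem (mem_Ioi.2 h), hinner a h]

lemma integrableOn_rieszKernel {α : ℝ} (hα : 1 / 2 < α) {x : Fin 3 → ℝ} (hx : ∀ i, 0 < x i) :
    IntegrableOn (fun y => exp (-(∑ i, y i * x i)) * rieszKernel α y) dualCone := by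
  have hm := measurable_rieszKernel α
  refine (lintegral_ofReal_ne_top_iff_integrable (Measurable.aestronglyMeasurable (by fun_prop))
    ?_).1 ?_
  · exact (ae_restrict_iff' measurableSet_dualCone).2 (ae_of_all _ fun y hy =>
      mul_nonneg (exp_pos _).le (rieszKernel_nonneg hα hy))
  · rw [lintegral_rieszKernel hα hx]
    exact ENNReal.ofReal_ne_top

lemma integral_rieszKernel {α : ℝ} (hα : 1 / 2 < α) {x : Fin 3 → ℝ} (hx : ∀ i, 0 < x i) :
    ∫ y in dualCone, exp (-(∑ i, y i * x i)) * rieszKernel α y =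
      (x 0 * x 1 + x 0 * x 2 + x 1 * x 2) ^ (-α) := by
  have hm := measurable_rieszKernel α
  have hx0 := hx 0
  have hx1 := hx 1
  have hx2 := hx 2
  rw [integral_eq_lintegral_of_nonneg_ae ?_ (Measurable.aestronglyMeasurable (by fun_prop)),
    lintegral_rieszKernel hα hx, ENNReal.toReal_ofReal (by positivity)]
  exact (ae_restrict_iff' measurableSet_dualCone).2 (ae_of_all _ fun y hy =>
    mul_nonneg (exp_pos _).le (rieszKernel_nonneg hα hy))

/-- For `α > 1/2`, the function `(x₁x₂+x₁x₃+x₂x₃)^{−α}` has the integral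
representation over `D = {y ≥ 0 : y₁y₂+y₁y₃+y₂y₃ ≥ (y₁²+y₂²+y₃²)/2}` with the explicit
Riesz kernel, and in particular it is completely monotone on the positive orthant of `ℝ³`. -/
theorem statement1 (α : ℝ) (hα : 1 / 2 < α) :
    (∀ x : Fin 3 → ℝ, (∀ i, 0 < x i) →
      (x 0 * x 1 + x 0 * x 2 + x 1 * x 2) ^ (-α) =
        ∫ y in {y : Fin 3 → ℝ | (∀ i, 0 ≤ y i) ∧
            (y 0 ^ 2 + y 1 ^ 2 + y 2 ^ 2) / 2 ≤ y 0 * y 1 + y 0 * y 2 + y 1 * y 2},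
          Real.exp (-(∑ i, y i * x i)) *
            (2 ^ (1 - α) / (Real.sqrt (2 * π) * Real.Gamma α * Real.Gamma (α - 1 / 2)) *
              (y 0 * y 1 + y 0 * y 2 + y 1 * y 2 -
                (y 0 ^ 2 + y 1 ^ 2 + y 2 ^ 2) / 2) ^ (α - 3 / 2))) ∧
    CompletelyMonotoneOn
      (fun x : Fin 3 → ℝ => (x 0 * x 1 + x 0 * x 2 + x 1 * x 2) ^ (-α))
      {x : Fin 3 → ℝ | ∀ i, 0 < x i} := by

  refine ⟨fun x hx => (integral_rieszKernel hα hx).symm, ?_⟩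
  have hadd : ∀ x ∈ {x : Fin 3 → ℝ | ∀ i, 0 < x i}, ∀ y ∈ {x : Fin 3 → ℝ | ∀ i, 0 < x i},
      x + y ∈ {x : Fin 3 → ℝ | ∀ i, 0 < x i} := fun x hx y hy i => add_pos (hx i) (hy i)
  refine completelyMonotoneOn_of_alternatingDifferences ?_ hadd
    (fun x hx t ht i => mul_pos ht (hx i)) ?_ fun n => ?_
  · simp only [ofPred_forall]
    exact isOpen_iInter_of_finite fun i => isOpen_lt continuous_const (continuous_apply i)
  · refine ContDiffOn.rpow_const_of_ne (by fun_prop) fun x hx => ?_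
    have hx0 := hx 0
    have hx1 := hx 1
    have hx2 := hx 2
    positivity
  · refine (alternatingDifferences_integral_exp (μ := volume.restrict dualCone)
      (p := fun y x => ∑ i, y i * x i) (w := rieszKernel α) hadd ?_ ?_ ?_ ?_ n).congr hadd
      fun x hx => integral_rieszKernel hα hx
    · intro y x x'
      simp only [Pi.add_apply, mul_add, Finset.sum_add_distrib]
    · exact (ae_restrict_iff' measurableSet_dualCone).2
        (ae_of_all _ fun y hy => rieszKernel_nonneg hα hy)
    · exact fun x hx => (ae_restrict_iff' measurableSet_dualCone).2
        (ae_of_all _ fun y hy => Finset.sum_nonneg fun i _ => mul_nonneg (hy.1 i) (hx i).le)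
    · exact fun x hx => integrableOn_rieszKernel hα hx
end

section
/- Let m ≥ 1, let C be the open cone of positive definite symmetric m×m real matrices inside the space of symmetric m×m matrices, and let α ∈ ℝ. The function x ↦ det(x)^{−α} is completely monotone on C if and only if α ∈ {0, 1/2, 1, 3/2, …, (m−1)/2} or α > (m−1)/2. -/
open MeasureTheory Real Set

/-- Nonnegativity on `C` of `f` and of its alternating finite differences of order at most `k`
with increments in `C`. -/
def AltDiffNonneg {E : Type*} [AddCommGroup E] (C : Set E) : ℕ → (E → ℝ) → Prop
  | 0, f => ∀ x ∈ C, 0 ≤ f x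
  | k + 1, f => (∀ x ∈ C, 0 ≤ f x) ∧ ∀ v ∈ C, AltDiffNonneg C k (fun x => f x - f (x + v))

namespace AltDiffNonneg

variable {E E' : Type*} [AddCommGroup E] [AddCommGroup E'] {C : Set E} {C' : Set E'}

lemma nonneg {k : ℕ} {f : E → ℝ} (h : AltDiffNonneg C k f) : ∀ x ∈ C, 0 ≤ f x := by
  cases k with
  | zero => exact h
  | succ k => exact h.1

lemma of_succ {k : ℕ} {f : E → ℝ} (h : AltDiffNonneg C (k + 1) f) : AltDiffNonneg C k f := by
  induction k generalizing f with
  | zero => exact h.1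
  | succ k ih => exact ⟨h.1, fun v hv => ih (h.2 v hv)⟩

lemma congr (hC : ∀ x ∈ C, ∀ y ∈ C, x + y ∈ C) {k : ℕ} {f g : E → ℝ}
    (h : AltDiffNonneg C k f) (hfg : ∀ x ∈ C, f x = g x) : AltDiffNonneg C k g := by
  induction k generalizing f g with
  | zero => exact fun x hx => hfg x hx ▸ h x hx
  | succ k ih =>
    refine ⟨fun x hx => hfg x hx ▸ h.1 x hx, fun v hv => ih (h.2 v hv) fun x hx => ?_⟩
    rw [hfg x hx, hfg _ (hC x hx v hv)]

lemma add {k : ℕ} {f g : E → ℝ} (hf : AltDiffNonneg C k f) (hg : AltDiffNonneg C k g) :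
    AltDiffNonneg C k (fun x => f x + g x) := by
  induction k generalizing f g with
  | zero => exact fun x hx => add_nonneg (hf x hx) (hg x hx)
  | succ k ih =>
    refine ⟨fun x hx => add_nonneg (hf.1 x hx) (hg.1 x hx), fun v hv => ?_⟩
    convert ih (hf.2 v hv) (hg.2 v hv) using 2
    ring

lemma shift (hC : ∀ x ∈ C, ∀ y ∈ C, x + y ∈ C) {k : ℕ} {f : E → ℝ} {w : E} (hw : w ∈ C)
    (hf : AltDiffNonneg C k f) : AltDiffNonneg C k (fun x => f (x + w)) := by
  induction k generalizing f with
  | zero => exact fun x hx => hf _ (hC x hx w hw)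
  | succ k ih =>
    refine ⟨fun x hx => hf.1 _ (hC x hx w hw), fun v hv => ?_⟩
    convert ih (hf.2 v hv) using 4
    abel

lemma mul (hC : ∀ x ∈ C, ∀ y ∈ C, x + y ∈ C) {k : ℕ} {f g : E → ℝ}
    (hf : AltDiffNonneg C k f) (hg : AltDiffNonneg C k g) :
    AltDiffNonneg C k (fun x => f x * g x) := by
  induction k generalizing f g with
  | zero => exact fun x hx => mul_nonneg (hf x hx) (hg x hx)
  | succ k ih =>
    refine ⟨fun x hx => mul_nonneg (hf.1 x hx) (hg.1 x hx), fun v hv => ?_⟩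
    convert (ih (hf.2 v hv) hg.of_succ).add (ih (hf.of_succ.shift hC hv) (hg.2 v hv)) using 2
    ring

lemma const (k : ℕ) {c : ℝ} (hc : 0 ≤ c) : AltDiffNonneg C k (fun _ => c) := by
  induction k generalizing c with
  | zero => exact fun _ _ => hc
  | succ k ih => exact ⟨fun _ _ => hc, fun v _ => by simpa using ih le_rfl⟩

lemma const_mul {k : ℕ} {f : E → ℝ} {c : ℝ} (hc : 0 ≤ c) (hf : AltDiffNonneg C k f) :
    AltDiffNonneg C k (fun x => c * f x) := by
  induction k generalizing f with
  | zero => exact fun x hx => mul_nonneg hc (hf x hx)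
  | succ k ih =>
    refine ⟨fun x hx => mul_nonneg hc (hf.1 x hx), fun v hv => ?_⟩
    simpa only [mul_sub] using ih (hf.2 v hv)

lemma comp (p : E →+ E') (hp : ∀ x ∈ C, p x ∈ C') {k : ℕ} {f : E' → ℝ}
    (hf : AltDiffNonneg C' k f) : AltDiffNonneg C k (fun x => f (p x)) := by
  induction k generalizing f with
  | zero => exact fun x hx => hf _ (hp x hx)
  | succ k ih =>
    refine ⟨fun x hx => hf.1 _ (hp x hx), fun v hv => ?_⟩
    simpa only [map_add] using ih (hf.2 _ (hp v hv))

lemma exp_neg (ℓ : E →+ ℝ) (hℓ : ∀ x ∈ C, 0 ≤ ℓ x) (k : ℕ) :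
    AltDiffNonneg C k (fun x => Real.exp (-ℓ x)) := by
  induction k with
  | zero => exact fun x _ => (Real.exp_pos _).le
  | succ k ih =>
    refine ⟨fun x _ => (Real.exp_pos _).le, fun v hv => ?_⟩
    have h : 0 ≤ 1 - Real.exp (-ℓ v) := by simpa using hℓ v hv
    convert ih.const_mul h using 2
    simp only [map_add, neg_add, Real.exp_add]
    ring

lemma integral (hC : ∀ x ∈ C, ∀ y ∈ C, x + y ∈ C) {T : Type*} [MeasurableSpace T]
    {μ : Measure T} {k : ℕ} {F : T → E → ℝ} (hF : ∀ᵐ t ∂μ, AltDiffNonneg C k (F t))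
    (hF_int : ∀ x ∈ C, Integrable (fun t => F t x) μ) :
    AltDiffNonneg C k (fun x => ∫ t, F t x ∂μ) := by
  induction k generalizing F with
  | zero => exact fun x hx => integral_nonneg_of_ae (hF.mono fun t ht => ht x hx)
  | succ k ih =>
    refine ⟨fun x hx => integral_nonneg_of_ae (hF.mono fun t ht => ht.1 x hx), fun v hv => ?_⟩
    refine congr hC (ih (F := fun t x => F t x - F t (x + v)) (hF.mono fun t ht => ht.2 v hv)
      fun x hx => (hF_int x hx).sub (hF_int _ (hC x hx v hv))) fun x hx => ?_
    exact integral_sub (hF_int x hx) (hF_int _ (hC x hx v hv))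

lemma of_tendsto (hC : ∀ x ∈ C, ∀ y ∈ C, x + y ∈ C) {ι : Type*} {l : Filter ι} [l.NeBot] {k : ℕ}
    {F : ι → E → ℝ} {f : E → ℝ} (hF : ∀ᶠ i in l, AltDiffNonneg C k (F i))
    (hlim : ∀ x ∈ C, Filter.Tendsto (fun i => F i x) l (nhds (f x))) : AltDiffNonneg C k f := by
  induction k generalizing F f with
  | zero => exact fun x hx => ge_of_tendsto (hlim x hx) (hF.mono fun i hi => hi x hx)
  | succ k ih =>
    refine ⟨fun x hx => ge_of_tendsto (hlim x hx) (hF.mono fun i hi => hi.1 x hx), fun v hv => ?_⟩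
    exact ih (F := fun i x => F i x - F i (x + v)) (hF.mono fun i hi => hi.2 v hv)
      fun x hx => (hlim x hx).sub (hlim _ (hC x hx v hv))

end AltDiffNonneg

lemma contDiffOn_iterDirDeriv {E : Type*} [NormedAddCommGroup E] [NormedSpace ℝ E] {U : Set E}
    (hU : IsOpen U) {f : E → ℝ} (hf : ContDiffOn ℝ (⊤ : ℕ∞) f U) (k : ℕ) (v : ℕ → E) :
    ContDiffOn ℝ (⊤ : ℕ∞) (iterDirDeriv k v f) U := by
  induction k generalizing v with
  | zero => exact hf
  | succ k ih =>
    have h := (ih fun i => v (i + 1)).fderiv_of_isOpen (m := (⊤ : ℕ∞)) hU (by simp)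
    exact h.clm_apply contDiffOn_const

lemma AltDiffNonneg.neg_fderiv {E : Type*} [NormedAddCommGroup E] [NormedSpace ℝ E] {C : Set E}
    (hC : ∀ x ∈ C, ∀ y ∈ C, x + y ∈ C) (hC' : ∀ x ∈ C, ∀ c : ℝ, 0 < c → c • x ∈ C)
    {f : E → ℝ} (hf : ∀ k, AltDiffNonneg C k f) (hd : ∀ x ∈ C, DifferentiableAt ℝ f x)
    {v : E} (hv : v ∈ C) (k : ℕ) : AltDiffNonneg C k (fun x => -fderiv ℝ f x v) := by
  refine of_tendsto hC (l := nhdsWithin (0 : ℝ) (Ioi 0))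
    (F := fun (h : ℝ) x => h⁻¹ * (f x - f (x + h • v))) ?_ fun x hx => ?_
  · filter_upwards [self_mem_nhdsWithin] with h hh
    exact ((hf (k + 1)).2 _ (hC' v hv h hh)).const_mul (inv_nonneg.2 (le_of_lt hh))
  · have h1 := ((hd x hx).hasFDerivAt.hasLineDerivAt v).tendsto_slope_zero_right
    refine h1.neg.congr fun h => ?_
    simp only [smul_eq_mul]
    ring

/-- A smooth function whose alternating finite differences along a convex cone are all
nonnegative is completely monotone on it. -/
lemma completelyMonotoneOn_of_altDiffNonneg {E : Type*} [NormedAddCommGroup E] [NormedSpace ℝ E]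
    {C U : Set E} (hC : ∀ x ∈ C, ∀ y ∈ C, x + y ∈ C)
    (hC' : ∀ x ∈ C, ∀ c : ℝ, 0 < c → c • x ∈ C) (hU : IsOpen U) (hCU : C ⊆ U) {f : E → ℝ}
    (hfU : ContDiffOn ℝ (⊤ : ℕ∞) f U) (hf : ∀ k, AltDiffNonneg C k f) :
    CompletelyMonotoneOn f C := by
  refine ⟨hfU.mono hCU, fun k v hv => ?_⟩
  suffices h : ∀ n, AltDiffNonneg C n (fun x => (-1 : ℝ) ^ k * iterDirDeriv k v f x) from
    fun x hx => (h 0).nonneg x hx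
  induction k generalizing v with
  | zero => simpa [iterDirDeriv] using hf
  | succ k ih =>
    intro n
    have hd : ∀ x ∈ C, DifferentiableAt ℝ (iterDirDeriv k (fun i => v (i + 1)) f) x := fun x hx =>
      ((contDiffOn_iterDirDeriv hU hfU k _).contDiffAt (hU.mem_nhds (hCU hx))).differentiableAt
        (by simp)
    refine (AltDiffNonneg.neg_fderiv hC hC' (ih (fun i => v (i + 1)) fun i => hv _)
      (fun x hx => (hd x hx).const_mul _) (hv 0) n).congr hC fun x hx => ?_
    rw [fderiv_const_mul (hd x hx)]
    simp only [smul_apply, smul_eq_mul, iterDirDeriv]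
    ring


section

open Matrix
open scoped MatrixOrder Matrix.Norms.L2Operator

lemma Matrix.PosSemidef.exists_transpose_mul_self {n : ℕ} {D : Matrix (Fin n) (Fin n) ℝ}
    (hD : D.PosSemidef) : ∃ B : Matrix (Fin n) (Fin n) ℝ, D = Bᵀ * B := by
  obtain ⟨B, hB⟩ := CStarAlgebra.nonneg_iff_eq_star_mul_self.mp hD.nonneg
  exact ⟨B, by simpa [star_eq_conjTranspose] using hB⟩

end

section Gaussian

open Matrix

lemma integrable_exp_neg_dotProduct_self (n : ℕ) :
    Integrable (fun g : Fin n → ℝ => Real.exp (-(g ⬝ᵥ g))) := by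
  have h := Integrable.fintype_prod (μ := fun _ : Fin n => (volume : Measure ℝ))
    (f := fun _ t => Real.exp (-1 * t ^ 2)) fun _ => integrable_exp_neg_mul_sq one_pos
  refine h.congr (ae_of_all _ fun g => ?_)
  simp only [← Real.exp_sum, dotProduct, ← Finset.sum_neg_distrib]
  congr 1
  exact Finset.sum_congr rfl fun i _ => by ring

lemma integral_exp_neg_dotProduct_self_pos (n : ℕ) :
    0 < ∫ g : Fin n → ℝ, Real.exp (-(g ⬝ᵥ g)) :=
  integral_exp_pos (integrable_exp_neg_dotProduct_self n)

lemma integral_exp_neg_quadratic {n : ℕ} {D : Matrix (Fin n) (Fin n) ℝ} (hD : D.PosDef) :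
    Integrable (fun g : Fin n → ℝ => Real.exp (-(g ⬝ᵥ D *ᵥ g))) ∧
      ∫ g : Fin n → ℝ, Real.exp (-(g ⬝ᵥ D *ᵥ g)) =
        (√D.det)⁻¹ * ∫ g : Fin n → ℝ, Real.exp (-(g ⬝ᵥ g)) := by
  obtain ⟨B, hB⟩ := hD.posSemidef.exists_transpose_mul_self
  have hdet : D.det = B.det ^ 2 := by rw [hB, det_mul, det_transpose, sq]
  have hB0 : B.det ≠ 0 := by
    intro h
    have := hD.det_pos
    simp [hdet, h] at this
  have hq : ∀ g : Fin n → ℝ, Real.exp (-(g ⬝ᵥ D *ᵥ g)) =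
      Real.exp (-(toLin' B g ⬝ᵥ toLin' B g)) := by
    intro g
    rw [toLin'_apply, hB, ← mulVec_mulVec, dotProduct_mulVec, vecMul_transpose]
  have hmap := Real.map_matrix_volume_pi_eq_smul_volume_pi hB0
  have hmeas : AEMeasurable (toLin' B) (volume : Measure (Fin n → ℝ)) :=
    (toLin' B).continuous_of_finiteDimensional.measurable.aemeasurable
  have hcont : Continuous fun g : Fin n → ℝ => Real.exp (-(g ⬝ᵥ g)) :=
    Real.continuous_exp.comp (continuous_id.dotProduct continuous_id).neg
  simp only [hq]
  constructor
  · have := (integrable_map_measure (μ := (volume : Measure (Fin n → ℝ)))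
      hcont.aestronglyMeasurable hmeas).1
    refine this ?_
    rw [hmap]
    exact (integrable_exp_neg_dotProduct_self n).smul_measure ENNReal.ofReal_ne_top
  · rw [← integral_map hmeas (f := fun g : Fin n → ℝ => Real.exp (-(g ⬝ᵥ g)))
      hcont.aestronglyMeasurable, hmap, integral_smul_measure,
      ENNReal.toReal_ofReal (abs_nonneg _), hdet, Real.sqrt_sq_eq_abs, abs_inv, smul_eq_mul]

/-- Completing the square with respect to all variables but the first one. -/
lemma exists_schur_complement {n : ℕ} {x : Matrix (Fin (n + 1)) (Fin (n + 1)) ℝ} (hx : x.PosDef) :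
    ∃ (w : Fin n → ℝ) (σ : ℝ), 0 < σ ∧ σ * (x.submatrix Fin.succ Fin.succ).det = x.det ∧
      ∀ (s : ℝ) (g : Fin n → ℝ),
        Fin.cons s (g + s • w) ⬝ᵥ x *ᵥ (Fin.cons s (g + s • w) : Fin (n + 1) → ℝ) =
          s ^ 2 * σ + g ⬝ᵥ x.submatrix Fin.succ Fin.succ *ᵥ g := by
  set D := x.submatrix Fin.succ Fin.succ with hDdef
  have hD : D.PosDef := hx.submatrix (Fin.succ_injective n)
  have hxs : xᵀ = x := by simpa using hx.isHermitian.eq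
  let b : Fin n → ℝ := fun i => x i.succ 0
  let w : Fin n → ℝ := -(D⁻¹ *ᵥ b)
  let W : Fin (n + 1) → ℝ := Fin.cons 1 w
  let σ : ℝ := (x *ᵥ W) 0
  have hDw : D *ᵥ w = -b := by
    simp only [w, mulVec_neg, mulVec_mulVec,
      mul_nonsing_inv D (isUnit_iff_ne_zero.2 hD.det_pos.ne'), one_mulVec]
  have hxcons : ∀ (t : ℝ) (g : Fin n → ℝ) (i : Fin n),
      (x *ᵥ (Fin.cons t g : Fin (n + 1) → ℝ)) i.succ = b i * t + (D *ᵥ g) i := by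
    intro t g i
    simp [mulVec, dotProduct, Fin.sum_univ_succ, b, hDdef]
  have hxW : x *ᵥ W = Fin.cons σ 0 := by
    ext i
    refine Fin.cases rfl (fun i => ?_) i
    rw [hxcons, hDw]
    simp
  have hWxW : W ⬝ᵥ x *ᵥ W = σ := by
    rw [hxW]
    simp [dotProduct, Fin.sum_univ_succ, W]
  have hW0 : W ≠ 0 := fun h => one_ne_zero (α := ℝ) (by simpa [W] using congrFun h 0)
  have hdet : σ * D.det = x.det := by
    have h1 : x.adjugate *ᵥ (x *ᵥ W) = x.det • W := by
      rw [mulVec_mulVec, adjugate_mul, smul_mulVec, one_mulVec]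
    have h2 := congrFun h1 0
    rw [hxW] at h2
    simp only [mulVec, dotProduct, Fin.sum_univ_succ, Fin.cons_zero, Fin.cons_succ, Pi.zero_apply,
      mul_zero, Finset.sum_const_zero, add_zero, Pi.smul_apply, W, smul_eq_mul, mul_one,
      adjugate_fin_succ_eq_det_submatrix] at h2
    rw [← h2]
    simp [hDdef, mul_comm, Fin.succAbove_zero]
  refine ⟨w, σ, ?_, hdet, fun s g => ?_⟩
  · simpa [hWxW] using hx.dotProduct_mulVec_pos hW0
  · have hsplit : (Fin.cons s (g + s • w) : Fin (n + 1) → ℝ) = s • W + Fin.cons 0 g := by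
      ext i
      refine Fin.cases ?_ (fun i => ?_) i
      · simp [W]
      · simp [W, add_comm]
    have h1 : (Fin.cons 0 g : Fin (n + 1) → ℝ) ⬝ᵥ x *ᵥ W = 0 := by
      rw [hxW]
      simp [dotProduct, Fin.sum_univ_succ]
    have h2 : W ⬝ᵥ x *ᵥ (Fin.cons 0 g : Fin (n + 1) → ℝ) = 0 := by
      rw [dotProduct_mulVec, ← mulVec_transpose, hxs, dotProduct_comm, h1]
    have h3 : (Fin.cons 0 g : Fin (n + 1) → ℝ) ⬝ᵥ x *ᵥ (Fin.cons 0 g : Fin (n + 1) → ℝ) =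
        g ⬝ᵥ D *ᵥ g := by
      rw [dotProduct, Fin.sum_univ_succ]
      simp [hxcons, dotProduct]
    rw [hsplit, mulVec_add, mulVec_smul, dotProduct_add, add_dotProduct, add_dotProduct,
      dotProduct_smul, dotProduct_smul, smul_dotProduct, smul_dotProduct, hWxW, h1, h2, h3]
    simp only [smul_eq_mul]
    ring

end Gaussian


section Sufficiency

open Matrix

lemma posDef_add_mem {n : ℕ} : ∀ x ∈ {x : Matrix (Fin n) (Fin n) ℝ | x.PosDef},
    ∀ y ∈ {x : Matrix (Fin n) (Fin n) ℝ | x.PosDef},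
      x + y ∈ {x : Matrix (Fin n) (Fin n) ℝ | x.PosDef} :=
  fun _ hx _ hy => PosDef.add hx hy

lemma altDiffNonneg_exp_neg_quadratic {n : ℕ} (z : Fin n → ℝ) (k : ℕ) :
    AltDiffNonneg {x : Matrix (Fin n) (Fin n) ℝ | x.PosDef} k
      (fun x => Real.exp (-(z ⬝ᵥ x *ᵥ z))) := by
  let ℓ : Matrix (Fin n) (Fin n) ℝ →+ ℝ :=
    { toFun := fun x => z ⬝ᵥ x *ᵥ z
      map_zero' := by simp
      map_add' := fun x y => by rw [add_mulVec, dotProduct_add] }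
  exact AltDiffNonneg.exp_neg ℓ
    (fun x hx => by
      change 0 ≤ z ⬝ᵥ x *ᵥ z
      simpa using (PosDef.posSemidef hx).dotProduct_mulVec_nonneg z) k

/-- The Laplace transform of the law of the first column in the Bartlett decomposition. -/
lemma altDiffNonneg_schur_rpow {n : ℕ} {α : ℝ} (hα : 0 < α) (k : ℕ) :
    AltDiffNonneg {x : Matrix (Fin (n + 1)) (Fin (n + 1)) ℝ | x.PosDef} k
      (fun x => (√(x.submatrix Fin.succ Fin.succ).det)⁻¹ *
        (x.det / (x.submatrix Fin.succ Fin.succ).det) ^ (-α)) := by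
  set J := ∫ g : Fin n → ℝ, Real.exp (-(g ⬝ᵥ g)) with hJ
  have hJ0 : 0 < J := integral_exp_neg_dotProduct_self_pos n
  let F : ℝ → Matrix (Fin (n + 1)) (Fin (n + 1)) ℝ → ℝ := fun r x =>
    ∫ g : Fin n → ℝ, Real.exp
      (-((Fin.cons √r g : Fin (n + 1) → ℝ) ⬝ᵥ x *ᵥ (Fin.cons √r g : Fin (n + 1) → ℝ)))
  have key : ∀ x : Matrix (Fin (n + 1)) (Fin (n + 1)) ℝ, x.PosDef → ∀ r : ℝ, 0 < r →
      Integrable (fun g : Fin n → ℝ => Real.exp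
        (-((Fin.cons √r g : Fin (n + 1) → ℝ) ⬝ᵥ x *ᵥ (Fin.cons √r g : Fin (n + 1) → ℝ)))) ∧
      F r x = (√(x.submatrix Fin.succ Fin.succ).det)⁻¹ * J *
        Real.exp (-((x.det / (x.submatrix Fin.succ Fin.succ).det) * r)) := by
    intro x hx r hr
    obtain ⟨w, σ, hσ, hdet, hq⟩ := exists_schur_complement hx
    have hD : (x.submatrix Fin.succ Fin.succ).PosDef := hx.submatrix (Fin.succ_injective n)
    have hσ' : x.det / (x.submatrix Fin.succ Fin.succ).det = σ := by
      rw [← hdet, mul_div_cancel_right₀ _ hD.det_pos.ne']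
    obtain ⟨hi, he⟩ := integral_exp_neg_quadratic hD
    have hq' : ∀ g : Fin n → ℝ, Real.exp (-((Fin.cons √r (g + √r • w) : Fin (n + 1) → ℝ) ⬝ᵥ
        x *ᵥ (Fin.cons √r (g + √r • w) : Fin (n + 1) → ℝ))) =
        Real.exp (-(σ * r)) *
          Real.exp (-(g ⬝ᵥ x.submatrix Fin.succ Fin.succ *ᵥ g)) := by
      intro g
      rw [hq, Real.sq_sqrt hr.le, ← Real.exp_add]
      congr 1
      ring
    constructor
    · have h := ((hi.const_mul (Real.exp (-(σ * r)))).congr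
        (ae_of_all _ fun g => (hq' g).symm)).comp_sub_right (√r • w)
      simpa only [sub_add_cancel] using h
    · simp only [F]
      rw [← integral_add_right_eq_self _ (√r • w)]
      simp only [hq']
      rw [integral_const_mul, he, hσ']
      ring
  have hF : ∀ r : ℝ, 0 < r → AltDiffNonneg {x : Matrix (Fin (n + 1)) (Fin (n + 1)) ℝ | x.PosDef} k
      (fun x => r ^ (α - 1) * F r x) := by
    intro r hr
    refine AltDiffNonneg.const_mul (Real.rpow_nonneg hr.le _) ?_
    exact AltDiffNonneg.integral posDef_add_mem
      (ae_of_all _ fun g => altDiffNonneg_exp_neg_quadratic _ k) fun x hx => (key x hx r hr).1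
  have hσpos : ∀ x : Matrix (Fin (n + 1)) (Fin (n + 1)) ℝ, x.PosDef →
      0 < x.det / (x.submatrix Fin.succ Fin.succ).det := fun x hx =>
    div_pos hx.det_pos (hx.submatrix (Fin.succ_injective n)).det_pos
  have heq : ∀ x : Matrix (Fin (n + 1)) (Fin (n + 1)) ℝ, x.PosDef →
      EqOn (fun r => r ^ (α - 1) * F r x) (fun r => (√(x.submatrix Fin.succ Fin.succ).det)⁻¹ * J *
        (r ^ (α - 1) *
          Real.exp (-((x.det / (x.submatrix Fin.succ Fin.succ).det) * r)))) (Ioi 0) := by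
    intro x hx r hr
    simp only [(key x hx r hr).2]
    ring
  have hI := AltDiffNonneg.integral posDef_add_mem (k := k) (μ := volume.restrict (Ioi (0 : ℝ)))
    (F := fun r x => r ^ (α - 1) * F r x)
    ((ae_restrict_iff' measurableSet_Ioi).2 (ae_of_all _ hF)) (fun x hx => by
      refine (integrableOn_congr_fun (heq x hx) measurableSet_Ioi).2 (Integrable.const_mul ?_ _)
      by_contra hcon
      have h0 := Real.integral_rpow_mul_exp_neg_mul_Ioi hα (hσpos x hx)
      rw [integral_undef hcon] at h0
      exact (mul_pos (Real.rpow_pos_of_pos (one_div_pos.2 (hσpos x hx)) _)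
        (Real.Gamma_pos_of_pos hα)).ne h0)
  refine (hI.const_mul (c := (J * Real.Gamma α)⁻¹)
    (inv_nonneg.2 (mul_nonneg hJ0.le (Real.Gamma_pos_of_pos hα).le))).congr posDef_add_mem
    fun x hx => ?_
  have h1 := setIntegral_congr_fun (μ := volume) measurableSet_Ioi (heq x hx)
  rw [h1, integral_const_mul, Real.integral_rpow_mul_exp_neg_mul_Ioi hα (hσpos x hx),
    one_div, Real.inv_rpow (hσpos x hx).le, Real.rpow_neg (hσpos x hx).le]
  have := (Real.Gamma_pos_of_pos hα).ne'
  field_simp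

lemma altDiffNonneg_det_rpow {n : ℕ} {α : ℝ}
    (hα : (∃ k : ℕ, α = k / 2) ∨ ((n : ℝ) - 1) / 2 < α) (k : ℕ) :
    AltDiffNonneg {x : Matrix (Fin n) (Fin n) ℝ | x.PosDef} k (fun x => x.det ^ (-α)) := by
  induction n generalizing α with
  | zero => simpa using AltDiffNonneg.const k zero_le_one
  | succ n ih =>
    rcases eq_or_ne α 0 with rfl | h0
    · simpa using AltDiffNonneg.const k zero_le_one
    have hpos : 0 < α := by
      rcases hα with ⟨j, rfl⟩ | hα
      · exact lt_of_le_of_ne (by positivity) h0.symm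
      · push_cast at hα
        have : (0 : ℝ) ≤ n := n.cast_nonneg
        linarith
    have hα' : (∃ k : ℕ, α - 1 / 2 = k / 2) ∨ ((n : ℝ) - 1) / 2 < α - 1 / 2 := by
      rcases hα with ⟨j, rfl⟩ | hα
      · left
        cases j with
        | zero => simp at h0
        | succ j => exact ⟨j, by push_cast; ring⟩
      · right
        push_cast at hα
        linarith
    let p : Matrix (Fin (n + 1)) (Fin (n + 1)) ℝ →+ Matrix (Fin n) (Fin n) ℝ :=
      { toFun := fun x => x.submatrix Fin.succ Fin.succ
        map_zero' := rfl
        map_add' := fun _ _ => rfl }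
    have h2 := (ih hα').comp p (C := {x : Matrix (Fin (n + 1)) (Fin (n + 1)) ℝ | x.PosDef})
      fun x hx => PosDef.submatrix hx (Fin.succ_injective n)
    refine ((altDiffNonneg_schur_rpow hpos k).mul posDef_add_mem h2).congr posDef_add_mem
      fun x hx => ?_
    have hx' : 0 < x.det := PosDef.det_pos hx
    have hD : 0 < (x.submatrix Fin.succ Fin.succ).det :=
      (PosDef.submatrix hx (Fin.succ_injective n)).det_pos
    change (√(x.submatrix Fin.succ Fin.succ).det)⁻¹ *
        (x.det / (x.submatrix Fin.succ Fin.succ).det) ^ (-α) *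
        (x.submatrix Fin.succ Fin.succ).det ^ (-(α - 1 / 2)) = x.det ^ (-α)
    rw [Real.div_rpow hx'.le hD.le, Real.sqrt_eq_rpow, ← Real.rpow_neg hD.le, neg_sub,
      sub_eq_add_neg, Real.rpow_add hD, Real.rpow_neg hD.le (1 / 2)]
    have h3 := (Real.rpow_pos_of_pos hD (1 / 2)).ne'
    have h4 := (Real.rpow_pos_of_pos hD (-α)).ne'
    field_simp

end Sufficiency


section ListDeriv

variable {E : Type*} [NormedAddCommGroup E] [NormedSpace ℝ E]

/-- The iterated directional derivative along the vectors of a list. -/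
noncomputable def listDeriv : List E → (E → ℝ) → E → ℝ
  | [], f => f
  | v :: l, f => fun x => fderiv ℝ (listDeriv l f) x v

lemma iterDirDeriv_getD (l : List E) (d : E) (f : E → ℝ) :
    iterDirDeriv l.length (fun i => l.getD i d) f = listDeriv l f := by
  induction l with
  | nil => rfl
  | cons v l ih =>
    simp only [List.length_cons, iterDirDeriv, listDeriv, List.getD_cons_succ, List.getD_cons_zero,
      ih]

variable {U : Set E} {f : E → ℝ}

lemma contDiffOn_listDeriv (hU : IsOpen U) (hf : ContDiffOn ℝ (⊤ : ℕ∞) f U) (l : List E) :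
    ContDiffOn ℝ (⊤ : ℕ∞) (listDeriv l f) U := by
  induction l with
  | nil => exact hf
  | cons v l ih =>
    exact (ih.fderiv_of_isOpen (m := (⊤ : ℕ∞)) hU (by simp)).clm_apply contDiffOn_const

lemma contDiffAt_listDeriv (hU : IsOpen U) (hf : ContDiffOn ℝ (⊤ : ℕ∞) f U) (l : List E) {x : E}
    (hx : x ∈ U) : ContDiffAt ℝ (⊤ : ℕ∞) (listDeriv l f) x :=
  (contDiffOn_listDeriv hU hf l).contDiffAt (hU.mem_nhds hx)

lemma fderiv_congr_of_eqOn (hU : IsOpen U) {g h : E → ℝ} (hgh : ∀ x ∈ U, g x = h x) {x : E}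
    (hx : x ∈ U) : fderiv ℝ g x = fderiv ℝ h x :=
  Filter.EventuallyEq.fderiv_eq (Filter.mem_of_superset (hU.mem_nhds hx) hgh)

lemma fderiv_fderiv_apply {g : E → ℝ} {x : E} (hg : ContDiffAt ℝ (⊤ : ℕ∞) g x) (T : E →L[ℝ] E)
    (v : E) : fderiv ℝ (fun y => fderiv ℝ g y (T y)) x v =
      fderiv ℝ (fderiv ℝ g) x v (T x) + fderiv ℝ g x (T v) := by
  have hd : DifferentiableAt ℝ (fderiv ℝ g) x :=
    (hg.fderiv_right (m := 1) (by norm_cast)).differentiableAt (by simp)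
  rw [fderiv_clm_apply hd T.differentiableAt]
  simp [add_comm]

lemma fderiv_fderiv_apply_const {g : E → ℝ} {x : E} (hg : ContDiffAt ℝ (⊤ : ℕ∞) g x) (u v : E) :
    fderiv ℝ (fun y => fderiv ℝ g y u) x v = fderiv ℝ (fderiv ℝ g) x v u := by
  have hd : DifferentiableAt ℝ (fderiv ℝ g) x :=
    (hg.fderiv_right (m := 1) (by norm_cast)).differentiableAt (by simp)
  rw [fderiv_clm_apply hd (differentiableAt_const u)]
  simp

lemma fderiv_fderiv_swap {g : E → ℝ} {x : E} (hg : ContDiffAt ℝ (⊤ : ℕ∞) g x) (u v : E) :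
    fderiv ℝ (fderiv ℝ g) x u v = fderiv ℝ (fderiv ℝ g) x v u :=
  hg.isSymmSndFDerivAt (by
    rw [minSmoothness_of_isRCLikeNormedField]
    exact WithTop.coe_le_coe.2 le_top) u v

lemma listDeriv_perm (hU : IsOpen U) (hf : ContDiffOn ℝ (⊤ : ℕ∞) f U) {l l' : List E}
    (h : l.Perm l') : ∀ x ∈ U, listDeriv l f x = listDeriv l' f x := by
  induction h with
  | nil => exact fun _ _ => rfl
  | cons v _ ih => exact fun x hx => by simp only [listDeriv, fderiv_congr_of_eqOn hU ih hx]
  | swap u v l =>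
    intro x hx
    have hg := contDiffAt_listDeriv hU hf l hx
    simp only [listDeriv]
    rw [fderiv_fderiv_apply_const hg, fderiv_fderiv_apply_const hg, fderiv_fderiv_swap hg]
  | trans _ _ ih₁ ih₂ => exact fun x hx => (ih₁ x hx).trans (ih₂ x hx)

/-- The lists obtained from a list by applying `T` to one of its entries. -/
def List.applyOnce {V : Type*} (T : V → V) : List V → List (List V)
  | [] => []
  | v :: l => (T v :: l) :: (List.applyOnce T l).map (v :: ·)

lemma fderiv_sum_listDeriv (hU : IsOpen U) (hf : ContDiffOn ℝ (⊤ : ℕ∞) f U) (L : List (List E))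
    {x : E} (hx : x ∈ U) (v : E) :
    DifferentiableAt ℝ (fun y => (L.map fun l => listDeriv l f y).sum) x ∧
    fderiv ℝ (fun y => (L.map fun l => listDeriv l f y).sum) x v =
      ((L.map (v :: ·)).map fun l => listDeriv l f x).sum := by
  induction L with
  | nil => simp
  | cons l L ih =>
    have hd : DifferentiableAt ℝ (listDeriv l f) x :=
      (contDiffAt_listDeriv hU hf l hx).differentiableAt (by simp)
    simp only [List.map_cons, List.sum_cons]
    refine ⟨hd.add ih.1, ?_⟩
    rw [fderiv_fun_add hd ih.1, add_apply, ih.2]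
    rfl

/-- If `f` is an eigenfunction of the linear vector field `T`, its iterated derivatives satisfy
the commuted equation. -/
lemma fderiv_listDeriv_linear_vectorField (hU : IsOpen U) (hf : ContDiffOn ℝ (⊤ : ℕ∞) f U)
    (T : E →L[ℝ] E) (c : ℝ) (hT : ∀ x ∈ U, fderiv ℝ f x (T x) = c * f x) (l : List E) :
    ∀ x ∈ U, fderiv ℝ (listDeriv l f) x (T x) = c * listDeriv l f x -
      ((l.applyOnce T).map fun l' => listDeriv l' f x).sum := by
  induction l with
  | nil => simpa [listDeriv, List.applyOnce] using hT
  | cons v l ih =>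
    intro x hx
    have hg := contDiffAt_listDeriv hU hf l hx
    have hd : DifferentiableAt ℝ (listDeriv l f) x := hg.differentiableAt (by simp)
    have h1 : fderiv ℝ (fun y => fderiv ℝ (listDeriv l f) y (T y)) x v = _ :=
      congrArg (· v) (fderiv_congr_of_eqOn hU ih hx)
    obtain ⟨hs, hs'⟩ := fderiv_sum_listDeriv hU hf (l.applyOnce T) hx v
    rw [fderiv_fderiv_apply hg, fderiv_fun_sub (hd.const_mul c) hs, fderiv_const_mul hd,
      sub_apply, hs', fderiv_fderiv_swap hg] at h1
    simp only [listDeriv, List.applyOnce, List.map_cons, List.sum_cons]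
    rw [fderiv_fderiv_apply_const hg]
    simp only [smul_apply, smul_eq_mul] at h1
    linarith

end ListDeriv


section States

variable {V : Type*} [AddCommGroup V] [Module ℝ V]

/-- A normalized positive symmetric multilinear functional on lists of vectors, with respect to the
cone `C` and the unit `e`. -/
structure IsListState (C : Set V) (e : V) (φ : List V → ℝ) : Prop where
  nil : φ [] = 1
  perm : ∀ l l', l.Perm l' → φ l = φ l'
  add : ∀ u v l, φ ((u + v) :: l) = φ (u :: l) + φ (v :: l)
  smul : ∀ (c : ℝ) v l, φ ((c • v) :: l) = c * φ (v :: l)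
  unit : ∀ l, φ (e :: l) = φ l
  nonneg : ∀ l, (∀ v ∈ l, v ∈ C) → 0 ≤ φ l

variable {C : Set V} {e : V}

namespace IsListState

lemma sub {φ : List V → ℝ} (h : IsListState C e φ) (u v : V) (l : List V) :
    φ ((u - v) :: l) = φ (u :: l) - φ (v :: l) := by
  have := h.add (u - v) v l
  rw [sub_add_cancel] at this
  linarith

lemma exists_bound_aux (hC : ∀ v : V, ∃ c : ℝ, 0 ≤ c ∧ c • e + v ∈ C ∧ c • e - v ∈ C)
    (l₁ : List V) (hl₁ : ∀ v ∈ l₁, v ∈ C) :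
    ∃ B : ℝ, ∀ φ : List V → ℝ, IsListState C e φ → |φ l₁| ≤ B := by
  induction l₁ with
  | nil => exact ⟨1, fun φ h => by simp [h.nil]⟩
  | cons v l ih =>
    obtain ⟨B, hB⟩ := ih fun u hu => hl₁ u (List.mem_cons_of_mem _ hu)
    obtain ⟨c, hc, -, hcv⟩ := hC v
    refine ⟨c * B, fun φ h => ?_⟩
    rw [abs_of_nonneg (h.nonneg _ hl₁)]
    have h1 : 0 ≤ φ ((c • e - v) :: l) := h.nonneg _ fun u hu => by
      rcases List.mem_cons.1 hu with rfl | hu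
      exacts [hcv, hl₁ u (List.mem_cons_of_mem _ hu)]
    rw [h.sub, h.smul, h.unit] at h1
    have h2 := mul_le_mul_of_nonneg_left ((le_abs_self _).trans (hB φ h)) hc
    linarith

lemma exists_bound (hC : ∀ v : V, ∃ c : ℝ, 0 ≤ c ∧ c • e + v ∈ C ∧ c • e - v ∈ C)
    (l₂ l₁ : List V) (hl₁ : ∀ v ∈ l₁, v ∈ C) :
    ∃ B : ℝ, ∀ φ : List V → ℝ, IsListState C e φ → |φ (l₂ ++ l₁)| ≤ B := by
  induction l₂ generalizing l₁ with
  | nil => exact exists_bound_aux hC l₁ hl₁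
  | cons v l ih =>
    obtain ⟨c, hc, hcv, -⟩ := hC v
    obtain ⟨B₁, hB₁⟩ := ih ((c • e + v) :: l₁) fun u hu => by
      rcases List.mem_cons.1 hu with rfl | hu
      exacts [hcv, hl₁ u hu]
    obtain ⟨B₂, hB₂⟩ := ih l₁ hl₁
    refine ⟨B₁ + c * B₂, fun φ h => ?_⟩
    have h1 : φ (l ++ (c • e + v) :: l₁) = c * φ (l ++ l₁) + φ (v :: l ++ l₁) := by
      rw [h.perm _ _ List.perm_middle, h.add, h.smul, h.unit]
      rfl
    have h2 : φ (v :: l ++ l₁) = φ (l ++ (c • e + v) :: l₁) - c * φ (l ++ l₁) := by linarith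
    rw [h2]
    refine (abs_sub _ _).trans (add_le_add (hB₁ φ h) ?_)
    rw [abs_mul, abs_of_nonneg hc]
    exact mul_le_mul_of_nonneg_left (hB₂ φ h) hc

lemma isClosed_setOf : IsClosed {φ : List V → ℝ | IsListState C e φ} := by
  have h : {φ : List V → ℝ | IsListState C e φ} =
      {φ | φ [] = 1} ∩ {φ | ∀ l l', l.Perm l' → φ l = φ l'} ∩
      {φ | ∀ u v l, φ ((u + v) :: l) = φ (u :: l) + φ (v :: l)} ∩
      {φ | ∀ (c : ℝ) v l, φ ((c • v) :: l) = c * φ (v :: l)} ∩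
      {φ | ∀ l, φ (e :: l) = φ l} ∩ {φ | ∀ l, (∀ v ∈ l, v ∈ C) → 0 ≤ φ l} := by
    ext φ
    exact ⟨fun h => ⟨⟨⟨⟨⟨h.1, h.2⟩, h.3⟩, h.4⟩, h.5⟩, h.6⟩,
      fun ⟨⟨⟨⟨⟨h1, h2⟩, h3⟩, h4⟩, h5⟩, h6⟩ => ⟨h1, h2, h3, h4, h5, h6⟩⟩
  rw [h]
  simp only [Set.ofPred_forall]
  refine ((((IsClosed.inter ?_ ?_).inter ?_).inter ?_).inter ?_).inter ?_
  · exact isClosed_eq (continuous_apply _) continuous_const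
  · exact isClosed_iInter fun l => isClosed_iInter fun l' => isClosed_iInter fun _ =>
      isClosed_eq (continuous_apply _) (continuous_apply _)
  · exact isClosed_iInter fun u => isClosed_iInter fun v => isClosed_iInter fun l =>
      isClosed_eq (continuous_apply ((u + v) :: l))
        ((continuous_apply (u :: l)).add (continuous_apply (v :: l)))
  · exact isClosed_iInter fun c => isClosed_iInter fun v => isClosed_iInter fun l =>
      isClosed_eq (continuous_apply _) (continuous_const.mul (continuous_apply _))
  · exact isClosed_iInter fun l => isClosed_eq (continuous_apply _) (continuous_apply _)
  · exact isClosed_iInter fun l => isClosed_iInter fun _ =>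
      isClosed_le continuous_const (continuous_apply _)

lemma isCompact_setOf (hC : ∀ v : V, ∃ c : ℝ, 0 ≤ c ∧ c • e + v ∈ C ∧ c • e - v ∈ C) :
    IsCompact {φ : List V → ℝ | IsListState C e φ} := by
  choose B hB using fun l : List V => exists_bound hC l [] (by simp)
  refine (isCompact_univ_pi fun l => isCompact_Icc (a := -B l) (b := B l)).of_isClosed_subset
    isClosed_setOf fun φ hφ l _ => ?_
  have := hB l φ hφ
  rw [List.append_nil] at this
  exact abs_le.1 this

lemma convex_setOf : Convex ℝ {φ : List V → ℝ | IsListState C e φ} := by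
  intro φ hφ ψ hψ a b ha hb hab
  refine ⟨?_, fun l l' h => ?_, fun u v l => ?_, fun c v l => ?_, fun l => ?_, fun l hl => ?_⟩ <;>
    simp only [Pi.add_apply, Pi.smul_apply, smul_eq_mul]
  · rw [hφ.nil, hψ.nil]
    linarith
  · rw [hφ.perm l l' h, hψ.perm l l' h]
  · rw [hφ.add, hψ.add]
    ring
  · rw [hφ.smul, hψ.smul]
    ring
  · rw [hφ.unit, hψ.unit]
  · exact add_nonneg (mul_nonneg ha (hφ.nonneg l hl)) (mul_nonneg hb (hψ.nonneg l hl))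

/-- Conditioning a state on a positive vector. -/
lemma condition {φ : List V → ℝ} (h : IsListState C e φ) {u : V} (hu : u ∈ C)
    (hφu : 0 < φ [u]) : IsListState C e (fun l => (φ [u])⁻¹ * φ (u :: l)) where
  nil := inv_mul_cancel₀ hφu.ne'
  perm l l' hl := by rw [h.perm _ _ (hl.cons u)]
  add v w l := by
    rw [h.perm _ _ (.swap (v + w) u l), h.add, h.perm _ _ (.swap u v l),
      h.perm _ _ (.swap u w l), mul_add]
  smul c v l := by
    rw [h.perm _ _ (.swap (c • v) u l), h.smul, h.perm _ _ (.swap u v l)]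
    ring
  unit l := by rw [h.perm _ _ (.swap e u l), h.unit]
  nonneg l hl := mul_nonneg (inv_nonneg.2 hφu.le) (h.nonneg _ fun v hv => by
    rcases List.mem_cons.1 hv with rfl | hv
    exacts [hu, hl v hv])

lemma mul_of_mem_extremePoints (he : e ∈ C) (hadd : ∀ x ∈ C, ∀ y ∈ C, x + y ∈ C)
    (hsmul : ∀ x ∈ C, ∀ c : ℝ, 0 < c → c • x ∈ C)
    (hC : ∀ v : V, ∃ c : ℝ, 0 ≤ c ∧ c • e + v ∈ C ∧ c • e - v ∈ C) {φ : List V → ℝ}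
    (hφ : φ ∈ {φ : List V → ℝ | IsListState C e φ}.extremePoints ℝ) (v : V) (l : List V) :
    φ (v :: l) = φ [v] * φ l := by
  obtain ⟨h, hext⟩ := hφ
  obtain ⟨c, hc, hcv, hcv'⟩ := hC v
  set a := (2 * (c + 1))⁻¹ with ha
  have ha0 : 0 < a := by positivity
  have hac : 2 * (a * (c + 1)) = 1 := by
    rw [ha]
    field_simp
  set u := a • ((c • e + v) + e) with hu
  have hu' : e - u = a • ((c • e - v) + e) := by
    have : e = (2 * (a * (c + 1))) • e := by rw [hac, one_smul]
    rw [hu]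
    nth_rewrite 1 [this]
    module
  have huC : u ∈ C := hsmul _ (hadd _ hcv _ he) _ ha0
  have huC' : e - u ∈ C := hu' ▸ hsmul _ (hadd _ hcv' _ he) _ ha0
  have hexp : ∀ l, φ (u :: l) = a * (φ (v :: l) + (c + 1) * φ l) := fun l => by
    rw [hu, h.smul, h.add, h.add, h.smul, h.unit]
    ring
  have he1 : φ [e] = 1 := by rw [h.unit, h.nil]
  have hpos : 0 < φ [u] := by
    have h1 : 0 ≤ φ [c • e + v] := h.nonneg _ (by simpa using hcv)
    rw [h.add, h.smul, he1] at h1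
    rw [hexp, h.nil]
    exact mul_pos ha0 (by linarith)
  have hlt : φ [e - u] = 1 - φ [u] := by rw [h.sub, he1]
  have hpos' : 0 < φ [e - u] := by
    have h1 : 0 ≤ φ [c • e - v] := h.nonneg _ (by simpa using hcv')
    rw [h.sub, h.smul, he1] at h1
    rw [hu', h.smul, h.add, h.sub, h.smul, he1]
    exact mul_pos ha0 (by linarith)
  have h1 := hext (h.condition huC hpos) (h.condition huC' hpos')
    ⟨φ [u], φ [e - u], hpos, hpos', by rw [hlt]; ring, by
      ext l
      simp only [Pi.add_apply, Pi.smul_apply, smul_eq_mul]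
      rw [mul_inv_cancel_left₀ hpos.ne', mul_inv_cancel_left₀ hpos'.ne', h.sub, h.unit]
      ring⟩
  have h2 : φ (u :: l) = φ [u] * φ l := by
    rw [← congrFun h1 l, mul_inv_cancel_left₀ hpos.ne']
  rw [hexp, hexp, h.nil] at h2
  have h3 : a * φ (v :: l) = a * (φ [v] * φ l) := by linarith
  exact mul_left_cancel₀ ha0.ne' h3

/-- Polynomial inequalities valid for all positive normalized linear functionals are valid for all
states. -/
theorem sum_nonneg (he : e ∈ C) (hadd : ∀ x ∈ C, ∀ y ∈ C, x + y ∈ C)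
    (hsmul : ∀ x ∈ C, ∀ c : ℝ, 0 < c → c • x ∈ C)
    (hC : ∀ v : V, ∃ c : ℝ, 0 ≤ c ∧ c • e + v ∈ C ∧ c • e - v ∈ C)
    {ι : Type*} (s : Finset ι) (a : ι → ℝ) (L : ι → List V)
    (hpos : ∀ ℓ : V →ₗ[ℝ] ℝ, (∀ v ∈ C, 0 ≤ ℓ v) → 0 ≤ ∑ i ∈ s, a i * ((L i).map ℓ).prod)
    {φ : List V → ℝ} (hφ : IsListState C e φ) : 0 ≤ ∑ i ∈ s, a i * φ (L i) := by
  let S : Set (List V → ℝ) := {ψ | 0 ≤ ∑ i ∈ s, a i * ψ (L i)}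
  have hS : IsClosed S := isClosed_le continuous_const
    (continuous_finsetSum _ fun i _ => continuous_const.mul (continuous_apply _))
  have hSc : Convex ℝ S := by
    intro ψ hψ χ hχ b c hb hc _
    have h : ∑ i ∈ s, a i * (b • ψ + c • χ) (L i) =
        b * ∑ i ∈ s, a i * ψ (L i) + c * ∑ i ∈ s, a i * χ (L i) := by
      rw [Finset.mul_sum, Finset.mul_sum, ← Finset.sum_add_distrib]
      refine Finset.sum_congr rfl fun i _ => ?_
      simp only [Pi.add_apply, Pi.smul_apply, smul_eq_mul]
      ring
    change 0 ≤ ∑ i ∈ s, a i * (b • ψ + c • χ) (L i)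
    rw [h]
    exact add_nonneg (mul_nonneg hb hψ) (mul_nonneg hc hχ)
  have hext : {φ : List V → ℝ | IsListState C e φ}.extremePoints ℝ ⊆ S := by
    intro ψ hψ
    have hstate : IsListState C e ψ := hψ.1
    let ℓ : V →ₗ[ℝ] ℝ :=
      { toFun := fun v => ψ [v]
        map_add' := fun u v => hstate.add u v []
        map_smul' := fun c v => hstate.smul c v [] }
    have hprod : ∀ l : List V, ψ l = (l.map ℓ).prod := by
      intro l
      induction l with
      | nil => simpa using hstate.nil
      | cons v l ih =>
        rw [mul_of_mem_extremePoints he hadd hsmul hC hψ, ih, List.map_cons, List.prod_cons]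
        rfl
    change 0 ≤ ∑ i ∈ s, a i * ψ (L i)
    simp only [hprod]
    exact hpos ℓ fun v hv => hstate.nonneg _ (by simpa using hv)
  have := closure_convexHull_extremePoints (isCompact_setOf hC) (convex_setOf (C := C) (e := e))
  exact (this ▸ closure_minimal (convexHull_min hext hSc) hS :
    {φ : List V → ℝ | IsListState C e φ} ⊆ S) hφ

end IsListState

end States

section Determinant

open Matrix

attribute [local instance] Matrix.normedAddCommGroup Matrix.normedSpace

variable {m : ℕ}

lemma contDiff_det : ContDiff ℝ (⊤ : ℕ∞) (fun x : Matrix (Fin m) (Fin m) ℝ => x.det) := by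
  simp only [Matrix.det_apply]
  refine ContDiff.sum fun σ _ => ContDiff.const_smul _ (contDiff_prod fun i _ => ?_)
  exact contDiff_apply_apply ℝ ℝ (σ i) i

lemma isOpen_det_pos : IsOpen {x : Matrix (Fin m) (Fin m) ℝ | 0 < x.det} :=
  isOpen_lt continuous_const contDiff_det.continuous

lemma contDiffOn_det_rpow (α : ℝ) : ContDiffOn ℝ (⊤ : ℕ∞)
    (fun x : Matrix (Fin m) (Fin m) ℝ => x.det ^ (-α)) {x | 0 < x.det} :=
  contDiff_det.contDiffOn.rpow_const_of_ne fun _ hx => (Set.mem_ofPred.1 hx).ne'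

lemma hasDerivAt_det_one_add_smul (A : Matrix (Fin m) (Fin m) ℝ) :
    HasDerivAt (fun t : ℝ => (1 + t • A).det) A.trace 0 := by
  have h := (Matrix.det (1 + (Polynomial.X : Polynomial ℝ) • A.map Polynomial.C)).hasDerivAt 0
  rw [Matrix.derivative_det_one_add_X_smul] at h
  refine (HasDerivAt.congr_deriv h rfl).congr_of_eventuallyEq (.of_forall fun t => ?_)
  dsimp only
  rw [← Polynomial.coe_evalRingHom, RingHom.map_det]
  congr 1
  ext i j
  by_cases hij : i = j <;> simp [hij, mul_comm t]

lemma fderiv_det_mul (A x : Matrix (Fin m) (Fin m) ℝ) :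
    fderiv ℝ (fun x : Matrix (Fin m) (Fin m) ℝ => x.det) x (A * x) = A.trace * x.det ∧
    fderiv ℝ (fun x : Matrix (Fin m) (Fin m) ℝ => x.det) x (x * A) = A.trace * x.det := by
  have hd : DifferentiableAt ℝ (fun x : Matrix (Fin m) (Fin m) ℝ => x.det) x :=
    contDiff_det.contDiffAt.differentiableAt (by simp)
  have h := (hasDerivAt_det_one_add_smul A).mul_const x.det
  have key : ∀ v : Matrix (Fin m) (Fin m) ℝ, (∀ t : ℝ, (x + t • v).det =
      (1 + t • A).det * x.det) →
      fderiv ℝ (fun x : Matrix (Fin m) (Fin m) ℝ => x.det) x v = A.trace * x.det := by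
    intro v hv
    refine (hd.lineDeriv_eq_fderiv (v := v)).symm.trans (HasDerivAt.deriv ?_)
    simpa only [hv] using h
  refine ⟨key _ fun t => ?_, key _ fun t => ?_⟩
  · rw [← Matrix.det_mul, add_mul, one_mul, smul_mul_assoc]
  · rw [mul_comm, ← Matrix.det_mul, mul_add, mul_one, mul_smul_comm]

/-- The linear vector field `x ↦ A x + x Aᵀ`. -/
noncomputable def congrField (A : Matrix (Fin m) (Fin m) ℝ) :
    Matrix (Fin m) (Fin m) ℝ →L[ℝ] Matrix (Fin m) (Fin m) ℝ :=
  LinearMap.toContinuousLinearMap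
    { toFun := fun x => A * x + x * Aᵀ
      map_add' := fun x y => by rw [mul_add, add_mul]; abel
      map_smul' := fun c x => by simp }

lemma congrField_apply (A x : Matrix (Fin m) (Fin m) ℝ) : congrField A x = A * x + x * Aᵀ := rfl

lemma fderiv_det_rpow_congrField (α : ℝ) (A x : Matrix (Fin m) (Fin m) ℝ) (hx : 0 < x.det) :
    fderiv ℝ (fun x : Matrix (Fin m) (Fin m) ℝ => x.det ^ (-α)) x (congrField A x) =
      -(2 * α * A.trace) * x.det ^ (-α) := by
  have hd : DifferentiableAt ℝ (fun x : Matrix (Fin m) (Fin m) ℝ => x.det) x :=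
    contDiff_det.contDiffAt.differentiableAt (by simp)
  refine (congrArg (fun L => L (congrField A x))
    (hd.hasFDerivAt.rpow_const (p := -α) (Or.inl hx.ne')).fderiv).trans ?_
  have h : fderiv ℝ (fun x : Matrix (Fin m) (Fin m) ℝ => x.det) x (congrField A x) =
      A.trace * x.det + A.trace * x.det := by
    rw [congrField_apply]
    refine (map_add _ _ _).trans (congrArg₂ (· + ·) (fderiv_det_mul A x).1 ?_)
    rw [(fderiv_det_mul Aᵀ x).2, Matrix.trace_transpose]
  refine (congrArg ((-α * x.det ^ (-α - 1)) * ·) h).trans ?_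
  rw [Real.rpow_sub_one hx.ne']
  field_simp
  ring


/-- A symmetric multilinear functional on lists of matrices satisfying the integration by parts
identity of the Wishart distribution with exponent `α`. -/
structure IsWishartFunctional (α : ℝ) (φ : List (Matrix (Fin m) (Fin m) ℝ) → ℝ) : Prop where
  nil : φ [] = 1
  perm : ∀ l l', l.Perm l' → φ l = φ l'
  add : ∀ u v l, φ ((u + v) :: l) = φ (u :: l) + φ (v :: l)
  smul : ∀ (c : ℝ) v l, φ ((c • v) :: l) = c * φ (v :: l)
  stein : ∀ A l, φ ((A + Aᵀ) :: l) = 2 * α * A.trace * φ l +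
    ((l.applyOnce fun x => A * x + x * Aᵀ).map φ).sum

lemma List.length_of_mem_applyOnce {V : Type*} (T : V → V) (l : List V) :
    ∀ l' ∈ l.applyOnce T, l'.length = l.length := by
  induction l with
  | nil => simp [List.applyOnce]
  | cons v l ih =>
    intro l' hl'
    rw [List.applyOnce, List.mem_cons, List.mem_map] at hl'
    rcases hl' with rfl | ⟨l'', h, rfl⟩
    · rfl
    · simp [ih l'' h]

lemma isWishartFunctional_listDeriv_det (α : ℝ) :
    IsWishartFunctional (m := m) α fun l => (-1) ^ l.length *
      listDeriv l (fun x : Matrix (Fin m) (Fin m) ℝ => x.det ^ (-α)) 1 := by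
  have h1 : (1 : Matrix (Fin m) (Fin m) ℝ) ∈ {x : Matrix (Fin m) (Fin m) ℝ | 0 < x.det} := by
    simp
  refine ⟨by simp [listDeriv], fun l l' h => ?_, fun u v l => ?_, fun c v l => ?_, fun A l => ?_⟩
  · rw [h.length_eq, listDeriv_perm isOpen_det_pos (contDiffOn_det_rpow α) h 1 h1]
  · simp only [listDeriv, List.length_cons]
    refine (congrArg ((-1) ^ (l.length + 1) * ·) (map_add _ u v)).trans (mul_add _ _ _)
  · simp only [listDeriv, List.length_cons]
    refine (congrArg ((-1) ^ (l.length + 1) * ·) (map_smul _ c v)).trans (mul_left_comm _ _ _)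
  · have h := fderiv_listDeriv_linear_vectorField isOpen_det_pos (contDiffOn_det_rpow α)
      (congrField A) (-(2 * α * A.trace)) (fun x hx => fderiv_det_rpow_congrField α A x hx) l 1 h1
    have hA : congrField A 1 = A + Aᵀ := by rw [congrField_apply, mul_one, one_mul]
    replace h : fderiv ℝ (listDeriv l fun x : Matrix (Fin m) (Fin m) ℝ => x.det ^ (-α)) 1
      (A + Aᵀ) = _ := (congrArg _ hA.symm).trans h
    have hs : ((l.applyOnce fun x => A * x + x * Aᵀ).map fun l' => (-1) ^ l'.length *
        listDeriv l' (fun x : Matrix (Fin m) (Fin m) ℝ => x.det ^ (-α)) 1).sum =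
        (-1) ^ l.length * ((l.applyOnce (congrField A)).map fun l' =>
          listDeriv l' (fun x : Matrix (Fin m) (Fin m) ℝ => x.det ^ (-α)) 1).sum := by
      rw [← List.sum_map_mul_left]
      refine congrArg List.sum (List.map_congr_left fun l' hl' => ?_)
      rw [List.length_of_mem_applyOnce _ _ l' hl']
    rw [hs]
    simp only [listDeriv, List.length_cons]
    have hring : ∀ c d s : ℝ, (-1) ^ (l.length + 1) * (-c * d - s) =
        c * ((-1) ^ l.length * d) + (-1) ^ l.length * s := fun c d s => by ring
    exact (congrArg ((-1) ^ (l.length + 1) * ·) h).trans (hring _ _ _)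

end Determinant

section WishartDeterminant

open Matrix

variable {m : ℕ}

/-- The symmetrized matrix units. -/
noncomputable def symUnit (i j : Fin m) : Matrix (Fin m) (Fin m) ℝ :=
  (1 / 2 : ℝ) • (Matrix.single i j 1 + Matrix.single j i 1)

lemma symUnit_comm (i j : Fin m) : symUnit i j = symUnit j i := by
  rw [symUnit, symUnit, add_comm]

lemma single_add_transpose (i j : Fin m) :
    Matrix.single i j (1 : ℝ) + (Matrix.single i j (1 : ℝ))ᵀ = (2 : ℝ) • symUnit i j := by
  rw [symUnit, smul_smul, transpose_single]
  norm_num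

lemma single_mul_symUnit_add_of_ne {i p a b : Fin m} (ha : a ≠ p) (hb : b ≠ p) :
    Matrix.single i p (1 : ℝ) * symUnit a b + symUnit a b * (Matrix.single i p (1 : ℝ))ᵀ = 0 := by
  simp [symUnit, mul_add, add_mul, single_mul_single_of_ne, ha.symm, hb.symm, ha, hb]

lemma single_mul_symUnit_add {i p j : Fin m} (hj : j ≠ p) :
    Matrix.single i p (1 : ℝ) * symUnit p j + symUnit p j * (Matrix.single i p (1 : ℝ))ᵀ =
      symUnit i j := by
  simp [symUnit, mul_add, add_mul, single_mul_single_of_ne, hj.symm, hj]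

namespace IsWishartFunctional

variable {α : ℝ} {φ : List (Matrix (Fin m) (Fin m) ℝ) → ℝ}

lemma eq_zero_of_zero_mem (h : IsWishartFunctional α φ) {l : List (Matrix (Fin m) (Fin m) ℝ)}
    (hl : 0 ∈ l) : φ l = 0 := by
  rw [h.perm _ _ (List.perm_cons_erase hl)]
  have := h.smul 0 0 (l.erase 0)
  rwa [zero_smul, zero_mul] at this

lemma sum_applyOnce_eq_zero (h : IsWishartFunctional α φ)
    (T : Matrix (Fin m) (Fin m) ℝ → Matrix (Fin m) (Fin m) ℝ)
    (l : List (Matrix (Fin m) (Fin m) ℝ)) (hT : ∀ v ∈ l, T v = 0) :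
    ∀ l₀, ((l.applyOnce T).map fun l' => φ (l₀ ++ l')).sum = 0 := by
  induction l with
  | nil => simp [List.applyOnce]
  | cons v l ih =>
    intro l₀
    rw [List.applyOnce, List.map_cons, List.sum_cons, hT v (by simp),
      h.eq_zero_of_zero_mem (by simp), List.map_map, zero_add]
    rw [← ih (fun u hu => hT u (List.mem_cons_of_mem _ hu)) (l₀ ++ [v])]
    simp [Function.comp_def]

lemma sum_applyOnce_id (l : List (Matrix (Fin m) (Fin m) ℝ))
    (T : Matrix (Fin m) (Fin m) ℝ → Matrix (Fin m) (Fin m) ℝ) (hT : ∀ v, T v = v) :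
    ∀ l₀, ((l.applyOnce T).map fun l' => φ (l₀ ++ l')).sum = l.length * φ (l₀ ++ l) := by
  induction l with
  | nil => simp [List.applyOnce]
  | cons v l ih =>
    intro l₀
    have := ih (l₀ ++ [v])
    simp only [List.append_assoc, List.singleton_append] at this
    rw [List.applyOnce, List.map_cons, List.sum_cons, hT v, List.map_map, Function.comp_def, this]
    push_cast [List.length_cons]
    ring

lemma one_cons (h : IsWishartFunctional α φ) (l : List (Matrix (Fin m) (Fin m) ℝ)) :
    φ (1 :: l) = (α * m + l.length) * φ l := by
  have h1 := h.stein ((1 / 2 : ℝ) • 1) l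
  have h2 : ((1 / 2 : ℝ) • (1 : Matrix (Fin m) (Fin m) ℝ)) + ((1 / 2 : ℝ) • 1)ᵀ = 1 := by
    rw [transpose_smul, transpose_one, ← add_smul]
    norm_num
  rw [h2, trace_smul, trace_one, Fintype.card_fin, smul_eq_mul] at h1
  have h3 := sum_applyOnce_id (φ := φ) l
    (fun x => ((1 / 2 : ℝ) • 1) * x + x * ((1 / 2 : ℝ) • (1 : Matrix (Fin m) (Fin m) ℝ))ᵀ)
    (fun v => by
      rw [transpose_smul, transpose_one, smul_mul_assoc, one_mul, mul_smul_comm, mul_one,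
        ← add_smul]
      norm_num) []
  simp only [List.nil_append] at h3
  rw [h1, h3]
  ring

lemma symUnit_self_cons (h : IsWishartFunctional α φ) (p : Fin m)
    (l : List (Matrix (Fin m) (Fin m) ℝ))
    (hl : ∀ v ∈ l, ∃ a b, a ≠ p ∧ b ≠ p ∧ v = symUnit a b) :
    φ (symUnit p p :: l) = α * φ l := by
  have h1 := h.stein (Matrix.single p p 1) l
  have h2 := h.sum_applyOnce_eq_zero
    (fun x => Matrix.single p p 1 * x + x * (Matrix.single p p (1 : ℝ))ᵀ) l (fun v hv => by
      obtain ⟨a, b, ha, hb, rfl⟩ := hl v hv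
      exact single_mul_symUnit_add_of_ne ha hb) []
  simp only [List.nil_append] at h2
  rw [single_add_transpose, h.smul, h2, trace_single_eq_same] at h1
  linarith

lemma symUnit_cons_symUnit_cons (h : IsWishartFunctional α φ) {i j p : Fin m} (hi : i ≠ p)
    (hj : j ≠ p) (l : List (Matrix (Fin m) (Fin m) ℝ))
    (hl : ∀ v ∈ l, ∃ a b, a ≠ p ∧ b ≠ p ∧ v = symUnit a b) :
    φ (symUnit i p :: symUnit p j :: l) = 1 / 2 * φ (symUnit i j :: l) := by
  have h1 := h.stein (Matrix.single i p 1) (symUnit p j :: l)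
  have h2 := h.sum_applyOnce_eq_zero
    (fun x => Matrix.single i p 1 * x + x * (Matrix.single i p (1 : ℝ))ᵀ) l (fun v hv => by
      obtain ⟨a, b, ha, hb, rfl⟩ := hl v hv
      exact single_mul_symUnit_add_of_ne ha hb) [symUnit p j]
  rw [List.applyOnce, List.map_cons, List.sum_cons, List.map_map, single_mul_symUnit_add hj] at h1
  have h3 : φ ∘ (symUnit p j :: ·) = fun l' => φ ([symUnit p j] ++ l') := rfl
  rw [h3, h2, single_add_transpose, h.smul, trace_single_eq_of_ne _ _ _ hi] at h1
  linarith

end IsWishartFunctional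

lemma List.exists_perm_ofFn_update {V : Type*} {n : ℕ} (g : Fin n → V) (i : Fin n) :
    ∃ l : List V, (∀ w, (List.ofFn (Function.update g i w)).Perm (w :: l)) ∧
      ∀ v ∈ l, ∃ j, v = g j := by
  refine ⟨(List.ofFn g).take i ++ (List.ofFn g).drop (i + 1), fun w => ?_, fun v hv => ?_⟩
  · have h : List.ofFn (Function.update g i w) = (List.ofFn g).set i w := by
      refine List.ext_getElem (by simp) fun k h1 h2 => ?_
      simp only [List.getElem_ofFn, List.getElem_set, Function.update_apply, Fin.ext_iff]
      simp only [eq_comm]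
    rw [h, List.set_eq_take_append_cons_drop, if_pos (by simp)]
    exact List.perm_middle
  · have : v ∈ List.ofFn g := by
      rcases List.mem_append.1 hv with h | h
      exacts [List.mem_of_mem_take h, List.mem_of_mem_drop h]
    obtain ⟨j, rfl⟩ := (List.mem_ofFn' g v).1 this
    exact ⟨j, rfl⟩

/-- The principal minor of the Wishart matrix has mean `∏ (α - i / 2)`. -/
lemma IsWishartFunctional.sum_sign {α : ℝ} {φ : List (Matrix (Fin m) (Fin m) ℝ) → ℝ}
    (h : IsWishartFunctional α φ) (n : ℕ) (ι : Fin n → Fin m) (hι : Function.Injective ι) :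
    ∑ σ : Equiv.Perm (Fin n), ((Equiv.Perm.sign σ : ℤ) : ℝ) *
      φ (List.ofFn fun i => symUnit (ι i) (ι (σ i))) = ∏ i ∈ Finset.range n, (α - i / 2) := by
  induction n with
  | zero => simp [h.nil]
  | succ n ih =>
    rw [← Equiv.Perm.decomposeFin.symm.sum_comp, Fintype.sum_prod_type, Fin.sum_univ_succ]
    have hne : ∀ i : Fin n, ι i.succ ≠ ι 0 := fun i h => Fin.succ_ne_zero i (hι h)
    have h0 : ∀ e : Equiv.Perm (Fin n), φ (List.ofFn fun i =>
        symUnit (ι i) (ι (Equiv.Perm.decomposeFin.symm (0, e) i))) =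
        α * φ (List.ofFn fun i => symUnit (ι i.succ) (ι (e i).succ)) := by
      intro e
      rw [List.ofFn_succ]
      simp only [Equiv.Perm.decomposeFin_symm_apply_zero, Equiv.Perm.decomposeFin_symm_apply_succ,
        Equiv.swap_self, Equiv.refl_apply]
      refine h.symUnit_self_cons _ _ fun v hv => ?_
      obtain ⟨i, rfl⟩ := (List.mem_ofFn' _ _).1 hv
      exact ⟨_, _, hne _, hne _, rfl⟩
    have h1 : ∀ (k : Fin n) (e : Equiv.Perm (Fin n)), φ (List.ofFn fun i =>
        symUnit (ι i) (ι (Equiv.Perm.decomposeFin.symm (k.succ, e) i))) =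
        1 / 2 * φ (List.ofFn fun i => symUnit (ι i.succ) (ι (e i).succ)) := by
      intro k e
      rw [List.ofFn_succ]
      simp only [Equiv.Perm.decomposeFin_symm_apply_zero, Equiv.Perm.decomposeFin_symm_apply_succ]
      set g : Fin n → Matrix (Fin m) (Fin m) ℝ := fun i => symUnit (ι i.succ) (ι (e i).succ)
        with hg
      obtain ⟨l, hl, hl'⟩ := List.exists_perm_ofFn_update g (e.symm k)
      have h2 : (fun i : Fin n => symUnit (ι i.succ) (ι (Equiv.swap 0 k.succ (e i).succ))) =
          Function.update g (e.symm k) (symUnit (ι 0) (ι (e.symm k).succ)) := by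
        funext i
        rcases eq_or_ne i (e.symm k) with rfl | hi
        · rw [Function.update_self, Equiv.apply_symm_apply, Equiv.swap_apply_right, symUnit_comm]
        · rw [Function.update_of_ne hi, Equiv.swap_apply_of_ne_of_ne (Fin.succ_ne_zero _)]
          intro h3
          exact hi ((Equiv.eq_symm_apply e).2 (Fin.succ_injective _ h3))
      have h3 := hl (g (e.symm k))
      rw [Function.update_eq_self] at h3
      rw [h2, h.perm _ _ ((hl _).cons _), h.perm _ _ h3, symUnit_comm (ι 0),
        h.symUnit_cons_symUnit_cons (hne _) (hne _) l fun v hv => ?_, hg]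
      · dsimp only
        rw [Equiv.apply_symm_apply, symUnit_comm]
      · obtain ⟨j, rfl⟩ := hl' v hv
        exact ⟨_, _, hne _, hne _, rfl⟩
    have ih' := ih (ι ∘ Fin.succ) (hι.comp (Fin.succ_injective n))
    simp only [Function.comp_apply] at ih'
    simp only [h0, h1, Equiv.Perm.decomposeFin.symm_sign, Fin.succ_ne_zero, if_true, if_false]
    rw [Finset.prod_range_succ, ← ih', Finset.sum_const, Finset.card_univ, Fintype.card_fin,
      nsmul_eq_mul, Finset.mul_sum, Finset.sum_mul, ← Finset.sum_add_distrib]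
    refine Finset.sum_congr rfl fun e _ => ?_
    push_cast
    ring

end WishartDeterminant

section WishartPositivity

open Matrix

variable {m : ℕ}

/-- The space of symmetric matrices. -/
abbrev SymmMatrix (m : ℕ) : Type :=
  selfAdjoint.submodule ℝ (Matrix (Fin m) (Fin m) ℝ)

/-- The cone of positive definite matrices in the space of symmetric matrices. -/
def posDefCone (m : ℕ) : Set (SymmMatrix m) := {v | (v : Matrix (Fin m) (Fin m) ℝ).PosDef}

/-- The identity matrix as a symmetric matrix. -/
def symmOne (m : ℕ) : SymmMatrix m := ⟨1, isHermitian_one⟩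

lemma isHermitian_symUnit (i j : Fin m) : (symUnit i j).IsHermitian := by
  rw [IsHermitian, conjTranspose_eq_transpose_of_trivial, symUnit, transpose_smul, transpose_add,
    transpose_single, transpose_single, add_comm]

lemma dotProduct_symUnit_mulVec (i j : Fin m) (x : Fin m → ℝ) :
    x ⬝ᵥ symUnit i j *ᵥ x = x i * x j := by
  have h : ∀ k c, x ⬝ᵥ Function.update 0 k c = x k * c := fun k c => dotProduct_single x c k
  rw [symUnit, smul_mulVec, add_mulVec, dotProduct_smul, dotProduct_add, single_mulVec,
    single_mulVec, h, h, smul_eq_mul]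
  ring

lemma abs_dotProduct_mulVec_le (v : Matrix (Fin m) (Fin m) ℝ) (x : Fin m → ℝ) :
    |x ⬝ᵥ v *ᵥ x| ≤ (∑ i, ∑ j, |v i j|) * (x ⬝ᵥ x) := by
  have hle : ∀ i, x i ^ 2 ≤ x ⬝ᵥ x := fun i => by
    rw [dotProduct, sq]
    exact Finset.single_le_sum (f := fun i => x i * x i) (fun j _ => mul_self_nonneg _)
      (Finset.mem_univ i)
  have habs : ∀ i j, |x i| * |x j| ≤ x ⬝ᵥ x := fun i j => by
    have h1 := sq_nonneg (|x i| - |x j|)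
    rw [sub_sq, sq_abs, sq_abs] at h1
    linarith [hle i, hle j]
  have h : x ⬝ᵥ v *ᵥ x = ∑ i, ∑ j, x i * (v i j * x j) := by
    simp only [dotProduct, mulVec, Finset.mul_sum]
  rw [h, Finset.sum_mul]
  refine (Finset.abs_sum_le_sum_abs _ _).trans (Finset.sum_le_sum fun i _ => ?_)
  rw [Finset.sum_mul]
  refine (Finset.abs_sum_le_sum_abs _ _).trans (Finset.sum_le_sum fun j _ => ?_)
  rw [abs_mul, abs_mul, mul_left_comm]
  exact mul_le_mul_of_nonneg_left (habs i j) (abs_nonneg _)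

lemma exists_smul_symmOne_add_mem (v : SymmMatrix m) :
    ∃ c : ℝ, 0 ≤ c ∧ c • symmOne m + v ∈ posDefCone m ∧ c • symmOne m - v ∈ posDefCone m := by
  set M : Matrix (Fin m) (Fin m) ℝ := v.1 with hM
  have hMh : M.IsHermitian := v.2
  set s := ∑ i, ∑ j, |M i j| with hs
  have hs0 : 0 ≤ s := Finset.sum_nonneg fun i _ => Finset.sum_nonneg fun j _ => abs_nonneg _
  have h1 : ((s + 1) • (1 : Matrix (Fin m) (Fin m) ℝ)).IsHermitian :=
    isHermitian_one.smul (IsSelfAdjoint.all _)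
  refine ⟨s + 1, by linarith, PosDef.of_dotProduct_mulVec_pos (h1.add hMh) fun x hx => ?_,
    PosDef.of_dotProduct_mulVec_pos (h1.sub hMh) fun x hx => ?_⟩
  all_goals
    have h2 : 0 < x ⬝ᵥ x := by simpa using dotProduct_star_self_pos_iff.2 hx
    have h3 := abs_le.1 (abs_dotProduct_mulVec_le M x)
    rw [← hs] at h3
    rw [star_trivial]
  · change 0 < x ⬝ᵥ ((s + 1) • (1 : Matrix (Fin m) (Fin m) ℝ) + M) *ᵥ x
    rw [add_mulVec, dotProduct_add, smul_mulVec, one_mulVec, dotProduct_smul, smul_eq_mul]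
    linarith
  · change 0 < x ⬝ᵥ ((s + 1) • (1 : Matrix (Fin m) (Fin m) ℝ) - M) *ᵥ x
    rw [sub_mulVec, dotProduct_sub, smul_mulVec, one_mulVec, dotProduct_smul, smul_eq_mul]
    linarith

lemma nonneg_of_posSemidef {ℓ : SymmMatrix m →ₗ[ℝ] ℝ} (hℓ : ∀ v ∈ posDefCone m, 0 ≤ ℓ v)
    {v : SymmMatrix m} (hv : (v : Matrix (Fin m) (Fin m) ℝ).PosSemidef) : 0 ≤ ℓ v := by
  have h : ∀ ε : ℝ, 0 < ε → 0 ≤ ε * ℓ (symmOne m) + ℓ v := fun ε hε => by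
    have := hℓ (ε • symmOne m + v) ((PosDef.one.smul hε).add_posSemidef hv)
    rwa [map_add, map_smul, smul_eq_mul] at this
  have ht : Filter.Tendsto (fun ε : ℝ => ε * ℓ (symmOne m) + ℓ v) (nhdsWithin 0 (Ioi 0))
      (nhds (ℓ v)) := by
    have : Continuous fun ε : ℝ => ε * ℓ (symmOne m) + ℓ v := by fun_prop
    simpa using (this.tendsto 0).mono_left nhdsWithin_le_nhds
  exact ge_of_tendsto ht (Filter.eventually_of_mem self_mem_nhdsWithin h)

lemma det_nonneg_of_positive {ℓ : SymmMatrix m →ₗ[ℝ] ℝ} (hℓ : ∀ v ∈ posDefCone m, 0 ≤ ℓ v)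
    {n : ℕ} (ι : Fin n → Fin m) :
    0 ≤ (Matrix.of fun i j => ℓ ⟨symUnit (ι i) (ι j), isHermitian_symUnit _ _⟩).det := by
  refine PosSemidef.det_nonneg (PosSemidef.of_dotProduct_mulVec_nonneg ?_ fun w => ?_)
  · ext i j
    simp only [conjTranspose_apply, of_apply, star_trivial, symUnit_comm (ι i)]
  · let S : SymmMatrix m :=
      ∑ i, ∑ j, (w i * w j) • ⟨symUnit (ι i) (ι j), isHermitian_symUnit _ _⟩
    have hS : (S : Matrix (Fin m) (Fin m) ℝ) = ∑ i, ∑ j, (w i * w j) • symUnit (ι i) (ι j) := by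
      simp [S]
    have hpos : (S : Matrix (Fin m) (Fin m) ℝ).PosSemidef := by
      refine PosSemidef.of_dotProduct_mulVec_nonneg S.2 fun x => ?_
      have h : x ⬝ᵥ (S : Matrix (Fin m) (Fin m) ℝ) *ᵥ x = (∑ i, w i * x (ι i)) ^ 2 := by
        simp only [hS, sum_mulVec, dotProduct_sum, smul_mulVec, dotProduct_smul,
          dotProduct_symUnit_mulVec, smul_eq_mul]
        rw [sq, Finset.sum_mul_sum]
        exact Finset.sum_congr rfl fun i _ => Finset.sum_congr rfl fun j _ => by ring
      rw [star_trivial, h]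
      positivity
    have h := nonneg_of_posSemidef hℓ hpos
    have hSℓ : ℓ S = ∑ i, ∑ j, (w i * w j) * ℓ ⟨symUnit (ι i) (ι j), isHermitian_symUnit _ _⟩ := by
      simp only [S, map_sum, map_smul, smul_eq_mul]
    rw [hSℓ] at h
    refine h.trans_eq ?_
    simp only [star_trivial, dotProduct, mulVec, of_apply, Finset.mul_sum]
    exact Finset.sum_congr rfl fun i _ => Finset.sum_congr rfl fun j _ => by ring

lemma IsWishartFunctional.isListState {α : ℝ} {φ : List (Matrix (Fin m) (Fin m) ℝ) → ℝ}
    (h : IsWishartFunctional α φ) (hα : 0 < α * m)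
    (hpos : ∀ l : List (Matrix (Fin m) (Fin m) ℝ), (∀ v ∈ l, v.PosDef) → 0 ≤ φ l) :
    IsListState (posDefCone m) (symmOne m) fun l =>
      (∏ i ∈ Finset.range l.length, (α * m + i))⁻¹ * φ (l.map Subtype.val) where
  nil := by simp [h.nil]
  perm l l' hl := by rw [hl.length_eq, h.perm _ _ (hl.map _)]
  add u v l := by
    simp only [List.map_cons, List.length_cons, Submodule.coe_add, h.add, mul_add]
  smul c v l := by
    simp only [List.map_cons, List.length_cons, Submodule.coe_smul, h.smul]
    ring
  unit l := by
    have h1 : (0 : ℝ) < α * m + l.length := by positivity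
    have h2 := h.one_cons (l.map Subtype.val)
    rw [List.length_map] at h2
    simp only [List.map_cons, List.length_cons, Finset.prod_range_succ, symmOne, h2]
    rw [mul_inv, mul_assoc, inv_mul_cancel_left₀ h1.ne']
  nonneg l hl := by
    refine mul_nonneg (inv_nonneg.2 (Finset.prod_nonneg fun i _ => by positivity)) (hpos _ ?_)
    intro v hv
    obtain ⟨u, hu, rfl⟩ := List.mem_map.1 hv
    exact hl u hu

lemma IsWishartFunctional.prod_nonneg {α : ℝ} {φ : List (Matrix (Fin m) (Fin m) ℝ) → ℝ}
    (h : IsWishartFunctional α φ) (hα : 0 < α * m)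
    (hpos : ∀ l : List (Matrix (Fin m) (Fin m) ℝ), (∀ v ∈ l, v.PosDef) → 0 ≤ φ l) {n : ℕ}
    (hn : n ≤ m) : 0 ≤ ∏ i ∈ Finset.range n, (α - i / 2) := by
  set ι : Fin n → Fin m := Fin.castLE hn
  rw [← h.sum_sign n ι (Fin.castLE_injective hn)]
  have key := (h.isListState hα hpos).sum_nonneg
    (show symmOne m ∈ posDefCone m from PosDef.one) (fun x hx y hy => PosDef.add hx hy)
    (fun x hx c hc => PosDef.smul hx hc) exists_smul_symmOne_add_mem Finset.univ
    (fun σ : Equiv.Perm (Fin n) => ((Equiv.Perm.sign σ : ℤ) : ℝ))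
    (fun σ => List.ofFn fun i => ⟨symUnit (ι i) (ι (σ i)), isHermitian_symUnit _ _⟩)
    (fun ℓ hℓ => by
      have := det_nonneg_of_positive hℓ ι
      rw [← det_transpose, det_apply'] at this
      simpa [List.map_ofFn, List.prod_ofFn] using this)
  have h0 : 0 < ∏ i ∈ Finset.range n, (α * m + i) := Finset.prod_pos fun i _ => by positivity
  simp only [List.length_ofFn, List.map_ofFn, Function.comp_def] at key
  have h1 := mul_nonneg h0.le key
  rw [Finset.mul_sum] at h1
  refine h1.trans_eq (Finset.sum_congr rfl fun σ _ => ?_)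
  rw [mul_left_comm, mul_inv_cancel_left₀ h0.ne']

lemma exists_eq_or_lt_of_prod_nonneg (hm : 1 ≤ m) {α : ℝ} (hα : 0 < α)
    (h : ∀ n ≤ m, 0 ≤ ∏ i ∈ Finset.range n, (α - i / 2)) :
    (∃ k : ℕ, k ≤ m - 1 ∧ α = k / 2) ∨ ((m : ℝ) - 1) / 2 < α := by
  by_contra! hcon
  obtain ⟨hne, hle⟩ := hcon
  set q := ⌈2 * α⌉₊ with hq
  have hqm : q ≤ m - 1 := by
    rw [hq, Nat.ceil_le]
    push_cast [hm]
    linarith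
  have h1 : 2 * α < q := lt_of_le_of_ne (Nat.le_ceil _) fun h => hne q hqm (by linarith)
  have h2 : (q : ℝ) < 2 * α + 1 := Nat.ceil_lt_add_one (by linarith)
  have h3 := h (q + 1) (by omega)
  rw [Finset.prod_range_succ] at h3
  have h4 : 0 < ∏ i ∈ Finset.range q, (α - i / 2) := Finset.prod_pos fun i hi => by
    have : (i : ℝ) + 1 ≤ q := by exact_mod_cast Finset.mem_range.1 hi
    linarith
  nlinarith [mul_neg_of_pos_of_neg h4 (show α - (q : ℝ) / 2 < 0 by linarith)]

end WishartPositivity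

section DetRpow

open Matrix

attribute [local instance] Matrix.normedAddCommGroup Matrix.normedSpace

variable {m : ℕ}

lemma exists_eq_or_lt_of_completelyMonotoneOn (hm : 1 ≤ m) {α : ℝ}
    (h : CompletelyMonotoneOn (fun x : Matrix (Fin m) (Fin m) ℝ => x.det ^ (-α)) {x | x.PosDef}) :
    (∃ k : ℕ, k ≤ m - 1 ∧ α = k / 2) ∨ ((m : ℝ) - 1) / 2 < α := by
  have hφ := isWishartFunctional_listDeriv_det (m := m) α
  have hm0 : (0 : ℝ) < m := by exact_mod_cast hm
  have hpos : ∀ l : List (Matrix (Fin m) (Fin m) ℝ), (∀ v ∈ l, v.PosDef) → 0 ≤ (-1) ^ l.length *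
      listDeriv l (fun x : Matrix (Fin m) (Fin m) ℝ => x.det ^ (-α)) 1 := by
    intro l hl
    rw [← iterDirDeriv_getD l 1]
    refine h.2 l.length (fun i => l.getD i 1) (fun i => ?_) 1 PosDef.one
    rcases lt_or_ge i l.length with hi | hi
    · rw [List.getD_eq_getElem _ _ hi]
      exact hl _ (List.getElem_mem hi)
    · rw [List.getD_eq_default _ _ hi]
      exact PosDef.one
  have h0 : 0 ≤ α := by
    have h1 := hpos [1] (by simpa using PosDef.one)
    have h2 := hφ.one_cons []
    rw [hφ.nil] at h2
    rw [h2] at h1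
    simp only [List.length_nil, Nat.cast_zero, add_zero, mul_one] at h1
    exact nonneg_of_mul_nonneg_left h1 hm0
  rcases h0.eq_or_lt with rfl | hα
  · exact Or.inl ⟨0, by simp⟩
  · exact exists_eq_or_lt_of_prod_nonneg hm hα fun n hn =>
      hφ.prod_nonneg (mul_pos hα hm0) hpos hn

lemma completelyMonotoneOn_det_rpow {α : ℝ}
    (hα : (∃ k : ℕ, α = k / 2) ∨ ((m : ℝ) - 1) / 2 < α) :
    CompletelyMonotoneOn (fun x : Matrix (Fin m) (Fin m) ℝ => x.det ^ (-α)) {x | x.PosDef} :=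
  completelyMonotoneOn_of_altDiffNonneg posDef_add_mem (fun _ hx _ hc => PosDef.smul hx hc)
    isOpen_det_pos (fun _ hx => PosDef.det_pos hx) (contDiffOn_det_rpow α)
    (altDiffNonneg_det_rpow hα)

end DetRpow


/-- **Scott–Sokal.** For `m ≥ 1` and `α ∈ ℝ`, the function `x ↦ det(x)^{−α}` is
completely monotone on the cone of positive definite symmetric `m×m` matrices (viewed inside
the space of `m×m` matrices, with derivatives taken along symmetric positive definite
directions) if and only if `α ∈ {0, 1/2, 1, …, (m−1)/2}` or `α > (m−1)/2`. -/
theorem statement7 (m : ℕ) (hm : 1 ≤ m) (α : ℝ) :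
    CompletelyMonotoneOn
      (fun x : Fin m → Fin m → ℝ => (Matrix.of x).det ^ (-α))
      {x : Fin m → Fin m → ℝ | (Matrix.of x).IsSymm ∧ (Matrix.of x).PosDef} ↔
    ((∃ k : ℕ, k ≤ m - 1 ∧ α = k / 2) ∨ ((m : ℝ) - 1) / 2 < α) := by
  have hset : {x : Fin m → Fin m → ℝ | (Matrix.of x).IsSymm ∧ (Matrix.of x).PosDef} =
      {x : Matrix (Fin m) (Fin m) ℝ | x.PosDef} :=
    Set.ext fun x => ⟨fun h => h.2, fun h => 
      ⟨(Matrix.conjTranspose_eq_transpose_of_trivial _).symm.trans h.isHermitian, h⟩⟩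
  rw [hset]
  exact ⟨exists_eq_or_lt_of_completelyMonotoneOn hm, fun h =>
    completelyMonotoneOn_det_rpow (h.imp_left fun ⟨k, _, hk⟩ => ⟨k, hk⟩)⟩
end

section
/- Let p ∈ ℝ[x₁,…,xₙ] be a homogeneous polynomial that is strictly positive on a nonempty open convex cone C ⊆ ℝⁿ, and suppose that for some real α > 0 the function p^{−α} is completely monotone on C. Then p is hyperbolic with respect to every e ∈ C, and the hyperbolicity cone of p contains C. -/
open MeasureTheory Real Set

/-- Evaluation of a real polynomial at a complex point. -/
noncomputable def evalC {n : ℕ} (p : MvPolynomial (Fin n) ℝ) (z : Fin n → ℂ) : ℂ :=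
  MvPolynomial.aeval z p

/-- `p` is hyperbolic with respect to `e`: `p(e) > 0` and for every `x ∈ ℝⁿ` the univariate
polynomial `t ↦ p(t·e − x)` has only real zeros. -/
def IsHyperbolicWrt {n : ℕ} (p : MvPolynomial (Fin n) ℝ) (e : Fin n → ℝ) : Prop :=
  0 < MvPolynomial.eval e p ∧
  ∀ x : Fin n → ℝ, ∀ z : ℂ,
    evalC p (fun i => z * (e i : ℂ) - (x i : ℂ)) = 0 → z.im = 0

/-- The hyperbolicity cone of `p` with respect to `e`: the connected component of
`{p ≠ 0}` containing `e`. -/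
def hypCone {n : ℕ} (p : MvPolynomial (Fin n) ℝ) (e : Fin n → ℝ) : Set (Fin n → ℝ) :=
  connectedComponentIn {x | MvPolynomial.eval x p ≠ 0} e

open Topology Filter

/-- The derivative of a polynomial along a constant vector. -/
noncomputable def polyDirDeriv {σ K : Type*} [Fintype σ] [CommRing K] (v : σ → K)
    (q : MvPolynomial σ K) : MvPolynomial σ K :=
  ∑ i, MvPolynomial.C (v i) * MvPolynomial.pderiv i q

/-- The polynomial `N` such that the iterated derivative of `p ^ (-a)` along the vectors of `l` is
`p ^ (-a - l.length) * N`. -/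
noncomputable def derivNum {σ K : Type*} [Fintype σ] [CommRing K] (p : MvPolynomial σ K) (a : K) :
    List (σ → K) → MvPolynomial σ K
  | [] => 1
  | v :: l => p * polyDirDeriv v (derivNum p a l) -
      MvPolynomial.C (a + l.length) * derivNum p a l * polyDirDeriv v p

section Algebra

variable {σ K L : Type*} [Fintype σ] [CommRing K] [CommRing L]

lemma polyDirDeriv_add (v : σ → K) (q r : MvPolynomial σ K) :
    polyDirDeriv v (q + r) = polyDirDeriv v q + polyDirDeriv v r := by
  simp [polyDirDeriv, mul_add, Finset.sum_add_distrib]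

lemma polyDirDeriv_C_mul (v : σ → K) (c : K) (q : MvPolynomial σ K) :
    polyDirDeriv v (MvPolynomial.C c * q) = MvPolynomial.C c * polyDirDeriv v q := by
  simp only [polyDirDeriv, MvPolynomial.pderiv_C_mul, Finset.mul_sum]
  exact Finset.sum_congr rfl fun i _ => by ring

lemma polyDirDeriv_smul_add_smul (u w : σ → K) (a b : K) (q : MvPolynomial σ K) :
    polyDirDeriv (a • u + b • w) q =
      MvPolynomial.C a * polyDirDeriv u q + MvPolynomial.C b * polyDirDeriv w q := by
  simp only [polyDirDeriv, Finset.mul_sum, ← Finset.sum_add_distrib]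
  refine Finset.sum_congr rfl fun i _ => ?_
  simp only [Pi.add_apply, Pi.smul_apply, smul_eq_mul, map_add, map_mul]
  ring

lemma polyDirDeriv_map (φ : K →+* L) (v : σ → K) (q : MvPolynomial σ K) :
    polyDirDeriv (φ ∘ v) (MvPolynomial.map φ q) = MvPolynomial.map φ (polyDirDeriv v q) := by
  simp [polyDirDeriv, MvPolynomial.pderiv_map]

lemma derivNum_map (φ : K →+* L) (p : MvPolynomial σ K) (a : K) (l : List (σ → K)) :
    derivNum (MvPolynomial.map φ p) (φ a) (l.map (φ ∘ ·)) =
      MvPolynomial.map φ (derivNum p a l) := by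
  induction l with
  | nil => simp [derivNum]
  | cons v l ih => simp [derivNum, ih, polyDirDeriv_map]

lemma derivNum_smul_add_smul (p : MvPolynomial σ K) (s : K) (u w : σ → K) (a b : K)
    (l₁ l₂ : List (σ → K)) :
    derivNum p s (l₁ ++ (a • u + b • w) :: l₂) =
      MvPolynomial.C a * derivNum p s (l₁ ++ u :: l₂) +
        MvPolynomial.C b * derivNum p s (l₁ ++ w :: l₂) := by
  induction l₁ with
  | nil =>
    simp only [List.nil_append, derivNum, polyDirDeriv_smul_add_smul]
    ring
  | cons v l ih =>
    simp only [List.cons_append, derivNum, ih, polyDirDeriv_add, polyDirDeriv_C_mul,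
      List.length_append, List.length_cons]
    ring

lemma MvPolynomial.IsHomogeneous.polyDirDeriv {q : MvPolynomial σ K} {m : ℕ}
    (hq : q.IsHomogeneous m) (v : σ → K) : (polyDirDeriv v q).IsHomogeneous (m - 1) :=
  MvPolynomial.IsHomogeneous.sum _ _ _ fun _ _ => hq.pderiv.C_mul _

lemma MvPolynomial.IsHomogeneous.eval_polyDirDeriv_self {q : MvPolynomial σ K} {m : ℕ}
    (hq : q.IsHomogeneous m) (x : σ → K) :
    MvPolynomial.eval x (_root_.polyDirDeriv x q) = m * MvPolynomial.eval x q := by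
  have h := congrArg (MvPolynomial.eval x) hq.sum_X_mul_pderiv
  simpa [_root_.polyDirDeriv] using h

lemma polyDirDeriv_of_isHomogeneous_zero {q : MvPolynomial σ K} (hq : q.IsHomogeneous 0)
    (v : σ → K) : polyDirDeriv v q = 0 := by
  rw [← MvPolynomial.totalDegree_zero_iff_isHomogeneous,
    MvPolynomial.totalDegree_eq_zero_iff_eq_C] at hq
  rw [hq]
  simp [polyDirDeriv]

lemma MvPolynomial.IsHomogeneous.derivNum {p : MvPolynomial σ K} {d : ℕ} (hp : p.IsHomogeneous d)
    (a : K) (l : List (σ → K)) : (derivNum p a l).IsHomogeneous (l.length * (d - 1)) := by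
  induction l with
  | nil => simpa [_root_.derivNum] using MvPolynomial.isHomogeneous_one σ K
  | cons v l ih =>
    have e : (v :: l).length * (d - 1) = l.length * (d - 1) + (d - 1) := by
      simp [add_mul]
    rw [e]
    refine MvPolynomial.IsHomogeneous.sub ?_ ((ih.C_mul _).mul (hp.polyDirDeriv v))
    rcases Nat.eq_zero_or_pos (l.length * (d - 1)) with h | h
    · rw [h] at ih
      rw [polyDirDeriv_of_isHomogeneous_zero ih, mul_zero]
      exact MvPolynomial.isHomogeneous_zero σ K _
    · have hd : 0 < d - 1 := Nat.pos_of_mul_pos_left h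
      have := hp.mul (ih.polyDirDeriv v)
      convert this using 1
      omega

lemma MvPolynomial.IsHomogeneous.eval_smul_point {q : MvPolynomial σ K} {m : ℕ}
    (hq : q.IsHomogeneous m) (c : K) (x : σ → K) :
    MvPolynomial.eval (c • x) q = c ^ m * MvPolynomial.eval x q := by
  rw [MvPolynomial.eval_eq, MvPolynomial.eval_eq, Finset.mul_sum]
  refine Finset.sum_congr rfl fun s hs => ?_
  have h := hq (MvPolynomial.mem_support_iff.mp hs)
  rw [Finsupp.weight_apply, Finsupp.sum_fintype _ _ (by simp)] at h
  simp only [Pi.one_apply, smul_eq_mul, mul_one] at h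
  have h2 : ∏ i ∈ s.support, c ^ s i = c ^ m := by
    rw [Finset.prod_pow_eq_pow_sum, ← h, Finset.sum_subset (Finset.subset_univ _)]
    intro i _ hi
    simpa using hi
  simp only [Pi.smul_apply, smul_eq_mul, mul_pow, Finset.prod_mul_distrib, h2]
  ring

end Algebra

lemma abs_eval_derivNum_replicate_le {σ : Type*} [Fintype σ] {p : MvPolynomial σ ℝ} {d : ℕ}
    (hp : p.IsHomogeneous d) {a : ℝ} (ha : 0 ≤ a) (e : σ → ℝ) (k : ℕ) :
    |MvPolynomial.eval e (derivNum p a (List.replicate k e))| ≤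
      |MvPolynomial.eval e p| ^ k * ∏ i ∈ Finset.range k, (a * d + i) := by
  induction k with
  | zero => simp [derivNum]
  | succ k ih =>
    have hN := hp.derivNum a (List.replicate k e)
    have key : |MvPolynomial.eval e (derivNum p a (List.replicate (k + 1) e))| ≤
        (a * d + k) * |MvPolynomial.eval e p| *
          |MvPolynomial.eval e (derivNum p a (List.replicate k e))| := by
      rw [List.replicate_succ, derivNum]
      simp only [map_sub, map_mul, MvPolynomial.eval_C, hN.eval_polyDirDeriv_self,
        hp.eval_polyDirDeriv_self, List.length_replicate]
      have h0 : 0 ≤ a * d + k := by positivity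
      rw [show (a * d + k) * |MvPolynomial.eval e p| = |(a * d + k) * MvPolynomial.eval e p| by
        rw [abs_mul, abs_of_nonneg h0], ← abs_mul]
      rcases Nat.eq_zero_or_pos d with rfl | hd
      · simp only [zero_tsub, mul_zero, Nat.cast_zero, zero_mul, sub_zero, abs_zero]
        positivity
      · rw [← abs_neg]
        refine le_of_eq (congrArg _ ?_)
        push_cast [Nat.cast_sub (Nat.succ_le_of_lt hd)]
        simp
        ring
    refine key.trans ?_
    rw [Finset.prod_range_succ, pow_succ]
    calc _ ≤ (a * d + k) * |MvPolynomial.eval e p| *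
          (|MvPolynomial.eval e p| ^ k * ∏ i ∈ Finset.range k, (a * d + i)) := by gcongr
      _ = _ := by ring

lemma norm_eval_derivNum_replicate_le {σ : Type*} [Fintype σ] {p : MvPolynomial σ ℝ} {a : ℝ}
    {C : Set (σ → ℝ)} {x : σ → ℝ}
    (hC : ∀ l : List (σ → ℝ), (∀ v ∈ l, v ∈ C) →
      0 ≤ (-1) ^ l.length * MvPolynomial.eval x (derivNum p a l))
    {u w : σ → ℝ} (hu : u ∈ C) (hw : w ∈ C) {b c : ℂ} {r : ℝ}
    (hb : ‖b‖ ≤ r) (hc : ‖c‖ ≤ r) (m : ℕ) (l : List (σ → ℝ)) (hl : ∀ v ∈ l, v ∈ C) :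
    ‖MvPolynomial.eval (Complex.ofRealHom ∘ x) (derivNum (MvPolynomial.map Complex.ofRealHom p) a
      (List.replicate m (b • (Complex.ofRealHom ∘ u) + c • (Complex.ofRealHom ∘ w)) ++
        l.map (Complex.ofRealHom ∘ ·)))‖ ≤
      r ^ m * ((-1) ^ (m + l.length) *
        MvPolynomial.eval x (derivNum p a (List.replicate m (u + w) ++ l))) := by
  have hr : 0 ≤ r := (norm_nonneg _).trans hb
  induction m generalizing l with
  | zero =>
    have h := derivNum_map Complex.ofRealHom p a l
    simp only [Complex.ofRealHom_eq_coe] at h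
    simp only [List.replicate_zero, List.nil_append, h, MvPolynomial.eval_map, pow_zero, one_mul,
      zero_add]
    rw [← MvPolynomial.eval₂_comp, Complex.ofRealHom_eq_coe, Complex.norm_real, Real.norm_eq_abs, ← abs_of_nonneg (hC l hl),
      abs_mul, abs_pow, abs_neg, abs_one, one_pow, one_mul]
  | succ m ih =>
    rw [List.replicate_succ', List.replicate_succ', List.append_assoc, List.append_assoc,
      List.singleton_append, List.singleton_append, derivNum_smul_add_smul]
    have e1 := ih (u :: l) (by simpa using ⟨hu, hl⟩)
    have e2 := ih (w :: l) (by simpa using ⟨hw, hl⟩)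
    have e3 := derivNum_smul_add_smul p a u w 1 1 (List.replicate m (u + w)) l
    simp only [one_smul, map_one, one_mul] at e3
    rw [e3]
    simp only [List.map_cons, List.length_cons] at e1 e2
    simp only [map_add, map_mul, MvPolynomial.eval_C]
    refine (norm_add_le _ _).trans ?_
    rw [norm_mul, norm_mul]
    refine (add_le_add (mul_le_mul hb e1 (norm_nonneg _) hr)
      (mul_le_mul hc e2 (norm_nonneg _) hr)).trans (le_of_eq ?_)
    ring

section Analysis

variable {σ 𝕜 : Type*} [Fintype σ] [NontriviallyNormedField 𝕜]

lemma MvPolynomial.hasDerivAt_eval_add_smul (q : MvPolynomial σ 𝕜) (x v : σ → 𝕜) (t : 𝕜) :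
    HasDerivAt (fun s : 𝕜 => MvPolynomial.eval (x + s • v) q)
      (MvPolynomial.eval (x + t • v) (polyDirDeriv v q)) t := by
  classical
  induction q using MvPolynomial.induction_on with
  | C a => simpa [polyDirDeriv] using hasDerivAt_const t a
  | add p q hp hq => simpa [polyDirDeriv_add] using hp.fun_add hq
  | mul_X p i hp =>
    have hX : HasDerivAt (fun s : 𝕜 => (x + s • v) i) (v i) t := by
      simpa using ((hasDerivAt_id t).mul_const (v i)).const_add (x i)
    have h := hp.fun_mul hX
    have e : polyDirDeriv v (p * MvPolynomial.X i) =
        polyDirDeriv v p * MvPolynomial.X i + p * MvPolynomial.C (v i) := by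
      simp only [polyDirDeriv, Derivation.leibniz, smul_eq_mul, MvPolynomial.pderiv_X, mul_add,
        Finset.sum_add_distrib, Finset.sum_mul]
      rw [add_comm]
      congr 1
      · exact Finset.sum_congr rfl fun j _ => by ring
      · rw [Finset.sum_eq_single i]
        · simp; ring
        · intro j _ hj
          simp [Ne.symm hj]
        · simp
    rw [e]
    simpa using h

lemma MvPolynomial.differentiable_eval (q : MvPolynomial σ ℝ) :
    Differentiable ℝ (fun x : σ → ℝ => MvPolynomial.eval x q) := by
  intro x
  induction q using MvPolynomial.induction_on with
  | C a => simp
  | add p q hp hq => simpa using hp.fun_add hq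
  | mul_X p i hp =>
    simp only [map_mul, MvPolynomial.eval_X]
    exact hp.mul (by fun_prop)

end Analysis

lemma iterDirDeriv_eval_rpow {σ : Type*} [Fintype σ] (p : MvPolynomial σ ℝ) (a : ℝ)
    {C : Set (σ → ℝ)} (hC : IsOpen C) (hpos : ∀ x ∈ C, 0 < MvPolynomial.eval x p)
    (e : σ → ℝ) (l : List (σ → ℝ)) : ∀ x ∈ C,
    iterDirDeriv l.length (fun i => l.getD i e) (fun x => MvPolynomial.eval x p ^ (-a)) x =
      MvPolynomial.eval x p ^ (-a - l.length) * MvPolynomial.eval x (derivNum p a l) := by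
  induction l with
  | nil => intro x _; simp [iterDirDeriv, derivNum]
  | cons v l ih =>
    intro x hx
    have hev : iterDirDeriv l.length (fun i => l.getD i e)
        (fun x => MvPolynomial.eval x p ^ (-a)) =ᶠ[𝓝 x] fun x =>
        MvPolynomial.eval x p ^ (-a - l.length) * MvPolynomial.eval x (derivNum p a l) := by
      filter_upwards [hC.mem_nhds hx] with y hy using ih y hy
    have hp0 : MvPolynomial.eval x p ≠ 0 := (hpos x hx).ne'
    have hd : DifferentiableAt ℝ (fun x =>
        MvPolynomial.eval x p ^ (-a - l.length) * MvPolynomial.eval x (derivNum p a l)) x :=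
      ((MvPolynomial.differentiable_eval p x).rpow_const (Or.inl hp0)).mul
        (MvPolynomial.differentiable_eval _ x)
    have h1 := (MvPolynomial.hasDerivAt_eval_add_smul p x v 0)
    have h2 := (MvPolynomial.hasDerivAt_eval_add_smul (derivNum p a l) x v 0)
    have h3 := (h1.rpow_const (p := -a - l.length) (Or.inl (by simpa using hp0))).mul h2
    simp only [List.length_cons, iterDirDeriv, List.getD_cons_zero, List.getD_cons_succ]
    rw [hev.fderiv_eq, ← hd.lineDeriv_eq_fderiv, lineDeriv]
    refine h3.deriv.trans ?_
    simp only [zero_smul, add_zero, derivNum, map_sub, map_mul, MvPolynomial.eval_C]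
    have e1 : MvPolynomial.eval x p ^ (-a - l.length) =
        MvPolynomial.eval x p ^ (-a - l.length - 1) * MvPolynomial.eval x p := by
      rw [← Real.rpow_add_one hp0]; congr 1; ring
    rw [e1, show -a - ((l.length + 1 : ℕ) : ℝ) = -a - l.length - 1 by push_cast; ring]
    ring

lemma iteratedDeriv_eval_cpow {σ : Type*} [Fintype σ] (p : MvPolynomial σ ℂ) (a : ℂ)
    (x v : σ → ℂ) (k : ℕ) : ∀ t : ℂ, MvPolynomial.eval (x + t • v) p ∈ Complex.slitPlane →
    iteratedDeriv k (fun s : ℂ => MvPolynomial.eval (x + s • v) p ^ (-a)) t =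
      MvPolynomial.eval (x + t • v) p ^ (-a - k) *
        MvPolynomial.eval (x + t • v) (derivNum p a (List.replicate k v)) := by
  induction k with
  | zero => intro t _; simp [derivNum]
  | succ k ih =>
    intro t ht
    have h1 := MvPolynomial.hasDerivAt_eval_add_smul p x v t
    have h2 := MvPolynomial.hasDerivAt_eval_add_smul (derivNum p a (List.replicate k v)) x v t
    have h3 := (h1.cpow_const (c := -a - k) ht).mul h2
    have hev : iteratedDeriv k (fun s : ℂ => MvPolynomial.eval (x + s • v) p ^ (-a)) =ᶠ[𝓝 t]
        fun t => MvPolynomial.eval (x + t • v) p ^ (-a - k) *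
          MvPolynomial.eval (x + t • v) (derivNum p a (List.replicate k v)) := by
      filter_upwards [h1.continuousAt.preimage_mem_nhds
        (Complex.isOpen_slitPlane.mem_nhds ht)] with s hs using ih s hs
    rw [iteratedDeriv_succ, hev.deriv_eq, List.replicate_succ]
    refine h3.deriv.trans ?_
    have hp0 : MvPolynomial.eval (x + t • v) p ≠ 0 := Complex.slitPlane_ne_zero ht
    have e1 : MvPolynomial.eval (x + t • v) p ^ (-a - k) =
        MvPolynomial.eval (x + t • v) p ^ (-a - k - 1) * MvPolynomial.eval (x + t • v) p := by
      rw [Complex.cpow_sub (-a - k) 1 hp0, Complex.cpow_one, div_mul_cancel₀ _ hp0]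
    simp only [derivNum, map_sub, map_mul, MvPolynomial.eval_C, List.length_replicate]
    rw [e1, show -a - ((k + 1 : ℕ) : ℂ) = -a - k - 1 by push_cast; ring]
    ring

/-- A nonzero solution of `P S' + a P' S = 0` with `a > 0` cannot be analytic at a zero of `P`. -/
lemma not_eventually_ode_of_eq_zero {P S : ℂ → ℂ} {z₀ : ℂ} {a : ℝ} (ha : 0 < a)
    (hP : AnalyticAt ℂ P z₀) (hS : AnalyticAt ℂ S z₀) (hP0 : P z₀ = 0)
    (hPne : ¬ ∀ᶠ z in 𝓝 z₀, P z = 0) (hSne : ¬ ∀ᶠ z in 𝓝 z₀, S z = 0) :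
    ¬ ∀ᶠ z in 𝓝 z₀, P z * deriv S z + a * deriv P z * S z = 0 := by
  intro hode
  obtain ⟨m, q, hq, hq0, hPq⟩ := hP.exists_eventuallyEq_pow_smul_nonzero_iff.mpr hPne
  obtain ⟨k, s, hs, hs0, hSs⟩ := hS.exists_eventuallyEq_pow_smul_nonzero_iff.mpr hSne
  have hm : 0 < m := by
    rcases Nat.eq_zero_or_pos m with rfl | h
    · have := hPq.self_of_nhds
      simp [hP0] at this
      exact absurd this.symm hq0
    · exact h
  have deriv_mul (f g : ℂ → ℂ) (j : ℕ) (hg : AnalyticAt ℂ g z₀)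
      (hf : ∀ᶠ z in 𝓝 z₀, f z = (z - z₀) ^ j • g z) :
      ∀ᶠ z in 𝓝 z₀, (z - z₀) * deriv f z = (z - z₀) ^ j * (j * g z + (z - z₀) * deriv g z) := by
    filter_upwards [hf.eventually_nhds, hg.eventually_analyticAt] with z hz hgz
    have h1 : HasDerivAt (fun z => (z - z₀) ^ j • g z)
        ((j * (z - z₀) ^ (j - 1) * 1) * g z + (z - z₀) ^ j * deriv g z) z := by
      simpa using (((hasDerivAt_id z).sub_const z₀).fun_pow j).fun_mul hgz.differentiableAt.hasDerivAt
    rw [Filter.EventuallyEq.deriv_eq hz, h1.deriv]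
    rcases j with _ | j
    · simp
    · simp only [Nat.add_sub_cancel, pow_succ]
      ring
  have hQ := deriv_mul P q m hq hPq
  have hT := deriv_mul S s k hs hSs
  set B : ℂ → ℂ := fun z => q z * (k * s z + (z - z₀) * deriv s z) +
    a * (m * q z + (z - z₀) * deriv q z) * s z with hB
  have hBc : ContinuousAt B z₀ := by
    have := hq.continuousAt
    have := hs.continuousAt
    have := hq.deriv.continuousAt
    have := hs.deriv.continuousAt
    fun_prop
  have hB0 : ∀ᶠ z in 𝓝[≠] z₀, B z = 0 := by
    filter_upwards [hQ.filter_mono nhdsWithin_le_nhds, hT.filter_mono nhdsWithin_le_nhds,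
      hPq.filter_mono nhdsWithin_le_nhds, hSs.filter_mono nhdsWithin_le_nhds,
      hode.filter_mono nhdsWithin_le_nhds, self_mem_nhdsWithin] with z h1 h2 h3 h4 h5 h6
    have hz : z - z₀ ≠ 0 := sub_ne_zero.mpr h6
    have h7 : (z - z₀) ^ m * (z - z₀) ^ k * B z = 0 := by
      simp only [smul_eq_mul] at h3 h4
      calc (z - z₀) ^ m * (z - z₀) ^ k * B z
          = ((z - z₀) ^ m * q z) * ((z - z₀) ^ k * (k * s z + (z - z₀) * deriv s z)) +
            a * ((z - z₀) ^ m * (m * q z + (z - z₀) * deriv q z)) * ((z - z₀) ^ k * s z) := by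
              simp only [hB]; ring
        _ = (z - z₀) * (P z * deriv S z + a * deriv P z * S z) := by
              rw [← h1, ← h2, ← h3, ← h4]; ring
        _ = 0 := by rw [h5, mul_zero]
    simpa [hz] using h7
  have hBz : B z₀ = 0 :=
    tendsto_nhds_unique_of_eventuallyEq (l := 𝓝[≠] z₀)
      (hBc.tendsto.mono_left nhdsWithin_le_nhds) tendsto_const_nhds hB0
  have h8 : ((k : ℂ) + a * m) * (q z₀ * s z₀) = 0 := by
    rw [← hBz]; simp [hB]; ring
  have h9 : ((k : ℂ) + a * m) ≠ 0 := by
    have : (0 : ℝ) < k + a * m := by positivity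
    exact_mod_cast this.ne'
  exact mul_ne_zero h9 (mul_ne_zero hq0 hs0) h8

/-- The Taylor series at `0` of a branch of `P ^ (-a)` does not converge beyond a zero of `P`. -/
lemma ne_zero_of_lt_radius {P : ℂ → ℂ} {a : ℝ} (ha : 0 < a) (hP : ∀ z, AnalyticAt ℂ P z)
    (h0 : P 0 ∈ Complex.slitPlane) {F : FormalMultilinearSeries ℂ ℂ ℂ}
    (hF : HasFPowerSeriesAt (fun z => P z ^ (-a : ℂ)) F 0) {z : ℂ}
    (hz : z ∈ Metric.eball (0 : ℂ) F.radius) : P z ≠ 0 := by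
  intro hPz
  have hrad : 0 < F.radius := hF.radius_pos
  have hS := F.hasFPowerSeriesOnBall hrad
  have hU : IsPreconnected (Metric.eball (0 : ℂ) F.radius) :=
    (convex_eball (0 : ℂ) F.radius).isPreconnected
  have hSU := hS.analyticOnNhd
  have h0U : (0 : ℂ) ∈ Metric.eball (0 : ℂ) F.radius := Metric.mem_eball_self hrad
  have heq : F.sum =ᶠ[𝓝 0] fun z => P z ^ (-a : ℂ) := by
    filter_upwards [hS.hasFPowerSeriesAt.eventually_hasSum_sub, hF.eventually_hasSum_sub]
      with y h1 h2 using h1.unique h2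
  have hslit : ∀ᶠ y in 𝓝 (0 : ℂ), P y ∈ Complex.slitPlane :=
    (hP 0).continuousAt.preimage_mem_nhds (Complex.isOpen_slitPlane.mem_nhds h0)
  have hode : Set.EqOn (fun z => P z * deriv F.sum z + a * deriv P z * F.sum z) 0
      (Metric.eball (0 : ℂ) F.radius) := by
    refine AnalyticOnNhd.eqOn_zero_of_preconnected_of_eventuallyEq_zero (𝕜 := ℂ) ?_ hU h0U ?_
    · intro y hy
      exact ((hP y).mul (hSU y hy).deriv).add
        ((analyticAt_const.mul (hP y).deriv).mul (hSU y hy))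
    · filter_upwards [heq.eventuallyEq_nhds, hslit] with y h1 h2
      have h3 := ((hP y).differentiableAt.hasDerivAt.cpow_const (c := (-a : ℂ)) h2).deriv
      rw [h1.deriv_eq, h1.self_of_nhds]
      refine (congrArg (fun w => P y * w + a * deriv P y * P y ^ (-a : ℂ)) h3).trans ?_
      have hne := Complex.slitPlane_ne_zero h2
      have e1 : P y ^ (-a : ℂ) = P y ^ (-a - 1 : ℂ) * P y := by
        rw [Complex.cpow_sub _ _ hne, Complex.cpow_one, div_mul_cancel₀ _ hne]
      simp only [Pi.zero_apply]
      rw [e1]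
      ring
  have hzU := Metric.isOpen_eball.mem_nhds hz
  have hP0 := Complex.slitPlane_ne_zero h0
  refine not_eventually_ode_of_eq_zero ha (hP z) (hSU z hz) hPz ?_ ?_
    (by filter_upwards [hzU] with y hy using hode hy)
  · intro h
    exact hP0 (AnalyticOnNhd.eqOn_zero_of_preconnected_of_eventuallyEq_zero
      (fun y _ => hP y) hU hz h h0U)
  · intro h
    have h1 := AnalyticOnNhd.eqOn_zero_of_preconnected_of_eventuallyEq_zero hSU hU hz h h0U
    rw [heq.self_of_nhds] at h1
    simp only [Pi.zero_apply, Complex.cpow_eq_zero_iff] at h1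
    exact hP0 h1.1

lemma summable_prod_div_factorial_mul_pow {b s : ℝ} (hb : 0 < b) (hs0 : 0 < s) (hs1 : s < 1) :
    Summable fun k : ℕ => (∏ i ∈ Finset.range k, (b + i)) / k.factorial * s ^ k := by
  have hpos (k : ℕ) : 0 < (∏ i ∈ Finset.range k, (b + i)) / k.factorial * s ^ k := by
    have : 0 < ∏ i ∈ Finset.range k, (b + i) := Finset.prod_pos fun i _ => by positivity
    positivity
  refine summable_of_ratio_test_tendsto_lt_one hs1 (.of_forall fun k => (hpos k).ne') ?_
  have h1 : Tendsto (fun k : ℕ => (1 + (b - 1) * (1 / ((k : ℝ) + 1))) * s) atTop (𝓝 s) := by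
    simpa using ((tendsto_one_div_add_atTop_nhds_zero_nat (𝕜 := ℝ)).const_mul
      (b - 1)).const_add 1 |>.mul_const s
  refine h1.congr fun k => ?_
  rw [Real.norm_of_nonneg (hpos _).le, Real.norm_of_nonneg (hpos _).le, eq_div_iff (hpos k).ne',
    Finset.prod_range_succ, Nat.factorial_succ, pow_succ]
  push_cast
  have : (k.factorial : ℝ) ≠ 0 := by positivity
  have : (k : ℝ) + 1 ≠ 0 := by positivity
  field_simp
  ring

lemma CompletelyMonotoneOn.derivNum_nonneg {σ : Type*} [Fintype σ] {p : MvPolynomial σ ℝ} {a : ℝ}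
    {C : Set (σ → ℝ)} (hC : IsOpen C) (hpos : ∀ x ∈ C, 0 < MvPolynomial.eval x p)
    (hcm : CompletelyMonotoneOn (fun x => MvPolynomial.eval x p ^ (-a)) C) {x : σ → ℝ}
    (hx : x ∈ C) (l : List (σ → ℝ)) (hl : ∀ v ∈ l, v ∈ C) :
    0 ≤ (-1) ^ l.length * MvPolynomial.eval x (derivNum p a l) := by
  have h := hcm.2 l.length (fun i => l.getD i x) ?_ x hx
  · rw [iterDirDeriv_eval_rpow p a hC hpos x l x hx, mul_left_comm] at h
    exact nonneg_of_mul_nonneg_right h (Real.rpow_pos_of_pos (hpos x hx) _)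
  · intro i
    rcases lt_or_ge i l.length with hi | hi
    · rw [List.getD_eq_getElem _ _ hi]
      exact hl _ (List.getElem_mem hi)
    · rwa [List.getD_eq_default _ _ hi]

/-- If all the derivatives of `p ^ (-a)` at `u + w` along `u` and `w` alternate in sign, then `p`
does not vanish at complex points near `u + w` in terms of `u` and `w`. -/
lemma eval_ne_zero_of_derivNum_nonneg {σ : Type*} [Fintype σ] {p : MvPolynomial σ ℝ} {d : ℕ}
    (hp : p.IsHomogeneous d) {a : ℝ} (ha : 0 < a) {C : Set (σ → ℝ)} {u w : σ → ℝ}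
    (hu : u ∈ C) (hw : w ∈ C) (hpos : 0 < MvPolynomial.eval (u + w) p)
    (hC : ∀ l : List (σ → ℝ), (∀ v ∈ l, v ∈ C) →
      0 ≤ (-1) ^ l.length * MvPolynomial.eval (u + w) (derivNum p a l))
    {b c : ℂ} {r : ℝ} (hr0 : 0 < r) (hr1 : r < 1) (hb : ‖b‖ ≤ r) (hc : ‖c‖ ≤ r) :
    MvPolynomial.eval (Complex.ofRealHom ∘ (u + w) +
      (b • (Complex.ofRealHom ∘ u) + c • (Complex.ofRealHom ∘ w)))
      (MvPolynomial.map Complex.ofRealHom p) ≠ 0 := by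
  set q := MvPolynomial.map Complex.ofRealHom p with hq
  set x : σ → ℂ := Complex.ofRealHom ∘ (u + w) with hx
  set v : σ → ℂ := b • (Complex.ofRealHom ∘ u) + c • (Complex.ofRealHom ∘ w) with hv
  have hqx : MvPolynomial.eval x q = (MvPolynomial.eval (u + w) p : ℝ) := by
    rw [hq, hx, MvPolynomial.eval_map, ← MvPolynomial.eval₂_comp, Complex.ofRealHom_eq_coe]
  have hslit : MvPolynomial.eval (x + (0 : ℂ) • v) q ∈ Complex.slitPlane := by
    rw [zero_smul, add_zero, hqx]
    exact Complex.ofReal_mem_slitPlane.mpr hpos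
  have hPan (z : ℂ) : AnalyticAt ℂ (fun s : ℂ => MvPolynomial.eval (x + s • v) q) z := by
    have hd : Differentiable ℂ (fun s : ℂ => MvPolynomial.eval (x + s • v) q) :=
      fun s => (MvPolynomial.hasDerivAt_eval_add_smul q x v s).differentiableAt
    exact hd.analyticAt z
  have hG := ((hPan 0).cpow (analyticAt_const (v := (-a : ℂ))) hslit).hasFPowerSeriesAt
  obtain ⟨ρ, hρ1, hρ2⟩ := exists_between ((one_lt_inv₀ hr0).mpr hr1)
  have hρ0 : 0 < ρ := zero_lt_one.trans hρ1
  have hsum := (summable_prod_div_factorial_mul_pow (b := a * d + 1) (by positivity)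
    (mul_pos hr0 hρ0) (by rwa [mul_comm, ← lt_div_iff₀ hr0, one_div])).mul_left
      (MvPolynomial.eval (u + w) p ^ (-a))
  have hrad : ENNReal.ofNNReal ⟨ρ, hρ0.le⟩ ≤ (FormalMultilinearSeries.ofScalars ℂ (fun k =>
      iteratedDeriv k (fun s : ℂ => MvPolynomial.eval (x + s • v) q ^ (-a : ℂ)) 0 /
        k.factorial)).radius := by
    refine FormalMultilinearSeries.le_radius_of_summable _
      (hsum.of_nonneg_of_le (fun k => mul_nonneg (norm_nonneg _) (pow_nonneg hρ0.le _)) fun k => ?_)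
    have h1 := norm_eval_derivNum_replicate_le hC hu hw hb hc k [] (by simp)
    have h2 : (-1) ^ k * MvPolynomial.eval (u + w) (derivNum p a (List.replicate k (u + w))) ≤
        |MvPolynomial.eval (u + w) (derivNum p a (List.replicate k (u + w)))| :=
      (le_abs_self _).trans_eq (by simp [abs_mul])
    have h3 := abs_eval_derivNum_replicate_le hp ha.le (u + w) k
    rw [abs_of_pos hpos] at h3
    simp only [List.append_nil, List.length_nil, add_zero, List.map_nil] at h1
    have h4 : ∏ i ∈ Finset.range k, (a * d + i) ≤ ∏ i ∈ Finset.range k, (a * d + 1 + (i : ℝ)) :=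
      Finset.prod_le_prod (fun i _ => by positivity) fun i _ => by linarith
    have h5 : ‖MvPolynomial.eval x (derivNum q a (List.replicate k v))‖ ≤
        r ^ k * (MvPolynomial.eval (u + w) p ^ k *
          ∏ i ∈ Finset.range k, (a * d + 1 + (i : ℝ))) := by
      refine h1.trans ?_
      exact mul_le_mul_of_nonneg_left (h2.trans (h3.trans (mul_le_mul_of_nonneg_left h4
        (by positivity)))) (by positivity)
    rw [FormalMultilinearSeries.ofScalars_norm, norm_div,
      iteratedDeriv_eval_cpow q a x v k 0 hslit, zero_smul, add_zero, norm_mul, hqx,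
      show (-a - k : ℂ) = ((-a - k : ℝ) : ℂ) by push_cast; ring, ← Complex.ofReal_cpow hpos.le,
      Complex.norm_real, Real.norm_of_nonneg (by positivity), Complex.norm_natCast]
    have h6 : MvPolynomial.eval (u + w) p ^ (-a - k : ℝ) * MvPolynomial.eval (u + w) p ^ k =
        MvPolynomial.eval (u + w) p ^ (-a) := by
      rw [← Real.rpow_natCast, ← Real.rpow_add hpos]
      congr 1
      ring
    calc _ ≤ MvPolynomial.eval (u + w) p ^ (-a - k : ℝ) * (r ^ k *
          (MvPolynomial.eval (u + w) p ^ k * ∏ i ∈ Finset.range k, (a * d + 1 + (i : ℝ)))) /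
          k.factorial * ρ ^ k := by
            gcongr
            exact le_rfl
      _ = _ := by
            rw [← h6, mul_pow]
            ring
  have hmem : (1 : ℂ) ∈ Metric.eball (0 : ℂ) (FormalMultilinearSeries.ofScalars ℂ (fun k =>
      iteratedDeriv k (fun s : ℂ => MvPolynomial.eval (x + s • v) q ^ (-a : ℂ)) 0 /
        k.factorial)).radius := by
    refine Metric.mem_eball.mpr (lt_of_lt_of_le ?_ hrad)
    rw [edist_dist, dist_zero_right, norm_one, ENNReal.ofReal_one]
    exact ENNReal.one_lt_coe_iff.mpr (NNReal.coe_lt_coe.mp hρ1)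
  simpa using ne_zero_of_lt_radius ha hPan hslit hG hmem

/-- `p` has no zero whose real part lies in `C`. -/
lemma CompletelyMonotoneOn.eval_add_I_smul_ne_zero {σ : Type*} [Fintype σ] {p : MvPolynomial σ ℝ}
    {d : ℕ} (hp : p.IsHomogeneous d) {a : ℝ} (ha : 0 < a) {C : Set (σ → ℝ)} (hC : IsOpen C)
    (hcone : ∀ x ∈ C, ∀ t : ℝ, 0 < t → t • x ∈ C) (hpos : ∀ x ∈ C, 0 < MvPolynomial.eval x p)
    (hcm : CompletelyMonotoneOn (fun x => MvPolynomial.eval x p ^ (-a)) C) {e : σ → ℝ}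
    (he : e ∈ C) (y : σ → ℝ) :
    MvPolynomial.eval (Complex.ofRealHom ∘ e + Complex.I • (Complex.ofRealHom ∘ y))
      (MvPolynomial.map Complex.ofRealHom p) ≠ 0 := by
  have hnear : ∀ᶠ s : ℝ in 𝓝 0, e + s • y ∈ C ∧ e + (-s) • y ∈ C := by
    have h1 : ContinuousAt (fun s : ℝ => e + s • y) 0 := by fun_prop
    have h2 : ContinuousAt (fun s : ℝ => e + (-s) • y) 0 := by fun_prop
    exact (h1.eventually_mem (hC.mem_nhds (by simpa using he))).and
      (h2.eventually_mem (hC.mem_nhds (by simpa using he)))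
  obtain ⟨δ, ⟨h1, h2⟩, hδ⟩ :=
    ((hnear.filter_mono (nhdsWithin_le_nhds (s := Ioi 0))).and self_mem_nhdsWithin).exists
  replace hδ : 0 < δ := hδ
  set u : σ → ℝ := (1 / 2 : ℝ) • (e + δ • y) with hu
  set w : σ → ℝ := (1 / 2 : ℝ) • (e + (-δ) • y) with hw
  have huw : u + w = e := by
    ext i; simp [hu, hw]; ring
  set t : ℝ := δ ^ 2 / (1 + δ ^ 2) with ht
  have ht0 : 0 < t := by positivity
  have ht1 : t < 1 := by rw [ht, div_lt_one (by positivity)]; linarith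
  have htδ : t ^ 2 / δ ^ 2 = t - t ^ 2 := by
    rw [ht]; field_simp; ring
  set b : ℂ := ⟨t - 1, t / δ⟩ with hb
  set c : ℂ := ⟨t - 1, -(t / δ)⟩ with hc
  have hsq : (t - 1) * (t - 1) + t / δ * (t / δ) = 1 - t := by
    have : t / δ * (t / δ) = t ^ 2 / δ ^ 2 := by ring
    rw [this, htδ]; ring
  have key := eval_ne_zero_of_derivNum_nonneg hp ha (hcone _ h1 (1 / 2) (by norm_num))
    (hcone _ h2 (1 / 2) (by norm_num)) (by rw [← hu, ← hw, huw]; exact hpos e he)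
    (by rw [← hu, ← hw, huw]; exact fun l hl => hcm.derivNum_nonneg hC hpos he l hl)
    (b := b) (c := c) (r := √(1 - t)) (by simpa using ht1)
    (by rw [Real.sqrt_lt' one_pos]; linarith)
    (by rw [Complex.norm_def, Complex.normSq_mk, hsq])
    (by rw [Complex.norm_def, Complex.normSq_mk, neg_mul_neg, hsq])
  rw [← hu, ← hw, huw] at key
  have hpt : Complex.ofRealHom ∘ e + (b • (Complex.ofRealHom ∘ u) + c • (Complex.ofRealHom ∘ w)) =
      (t : ℂ) • (Complex.ofRealHom ∘ e + Complex.I • (Complex.ofRealHom ∘ y)) := by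
    ext i
    apply Complex.ext
    · simp [hu, hw, hb, hc]
      ring
    · simp [hu, hw, hb, hc]
      field_simp
      ring
  rw [hpt, (hp.map _).eval_smul_point] at key
  exact right_ne_zero_of_mul key


/-- If a homogeneous polynomial `p` is positive on a nonempty open convex
cone `C` and `p^{−α}` is completely monotone on `C` for some `α > 0`, then `p` is hyperbolic
with respect to every `e ∈ C` and the hyperbolicity cone of `p` contains `C`. -/
theorem statement11 (n : ℕ) (p : MvPolynomial (Fin n) ℝ) (d : ℕ) (hhom : p.IsHomogeneous d)
    (C : Set (Fin n → ℝ)) (hCne : C.Nonempty) (hopen : IsOpen C) (hconv : Convex ℝ C)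
    (hcone : ∀ x ∈ C, ∀ t : ℝ, 0 < t → t • x ∈ C)
    (hpos : ∀ x ∈ C, 0 < MvPolynomial.eval x p)
    (α : ℝ) (hα : 0 < α)
    (hcm : CompletelyMonotoneOn (fun x => MvPolynomial.eval x p ^ (-α)) C) :
    ∀ e ∈ C, IsHyperbolicWrt p e ∧ C ⊆ hypCone p e := by
  intro e he
  refine ⟨⟨hpos e he, fun x z hz => ?_⟩, ?_⟩
  · by_contra him
    refine hcm.eval_add_I_smul_ne_zero hhom hα hopen hcone hpos he
      (fun i => (x i - z.re * e i) / z.im) ?_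
    have hpt : (Complex.ofRealHom ∘ e +
        Complex.I • (Complex.ofRealHom ∘ fun i => (x i - z.re * e i) / z.im)) =
        (-Complex.I / z.im) • fun i => z * (e i : ℂ) - (x i : ℂ) := by
      ext i
      have him' : (z.im : ℂ) ≠ 0 := by exact_mod_cast him
      simp only [Pi.add_apply, Pi.smul_apply, Function.comp_apply, Complex.ofRealHom_eq_coe,
        smul_eq_mul, Complex.ofReal_div, Complex.ofReal_sub, Complex.ofReal_mul]
      field_simp
      linear_combination (-Complex.I * e i) * Complex.re_add_im z + (z.im * e i : ℂ) * Complex.I_sq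
    rw [hpt, (hhom.map _).eval_smul_point]
    rw [evalC, MvPolynomial.aeval_def] at hz
    rw [MvPolynomial.eval_map]
    exact mul_eq_zero_of_right _ hz
  · exact hconv.isPreconnected.subset_connectedComponentIn he fun x hx => (hpos x hx).ne'
end
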